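/- arXiv:1610.02727 — 8 statements merged into one kernel-verified Lean document; each statement's English description precedes it below -/
import Mathlib

section
/- Let (X,T) be a topological dynamical system, i.e., X a nonempty compact metric space and T : X → X a homeomorphism. Then (X,T) is topologically conjugate to a subshift (Y,S) over some finite alphabet Λ if and only if X is zero-dimensional and T is expansive, i.e., there exists ε > 0 such that for all x ≠ y in X there is n ∈ ℤ with d(Tⁿx, Tⁿy) ≥ ε. -/
open TopologicalSpace

/-- The shift map on bi-infinite sequences over an alphabet `Λ`. -/
def shiftMap {Λ : Type*} (x : ℤ → Λ) : ℤ → Λ := fun n => x (n + 1)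

/-- A topology has a basis of clopen sets (zero-dimensionality). -/
def ZeroDim (X : Type*) [TopologicalSpace X] : Prop :=
  ∃ B : Set (Set X), (∀ s ∈ B, IsClopen s) ∧ IsTopologicalBasis B

theorem Homeomorph.continuous_toEquiv_zpow {X : Type*} [TopologicalSpace X] (T : X ≃ₜ X) (n : ℤ) :
    Continuous (T.toEquiv ^ n : Equiv.Perm X) := by
  induction n with
  | zero => exact continuous_id
  | succ n ih =>
    rw [zpow_add_one, Equiv.Perm.coe_mul]
    exact ih.comp T.continuous
  | pred n ih =>
    rw [zpow_sub_one, Equiv.Perm.coe_mul]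
    exact ih.comp T.symm.continuous

/-- A map intertwining a permutation with the shift is determined by its zeroth coordinate
along orbits. -/
theorem zpow_apply_of_semiconj_shiftMap {X Λ : Type*} (T : Equiv.Perm X) (φ : X → ℤ → Λ)
    (h : ∀ x, φ (T x) = shiftMap (φ x)) (n : ℤ) (x : X) (k : ℤ) :
    φ ((T ^ n) x) k = φ x (k + n) := by
  induction n generalizing k with
  | zero => simp
  | succ n ih =>
    rw [add_comm (n : ℤ) 1, zpow_one_add, Equiv.Perm.mul_apply, h, shiftMap, ih]
    ring_nf
  | pred n ih =>
    have h' := congrFun (h ((T ^ (-(n : ℤ) - 1)) x)) (k - 1)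
    rw [← Equiv.Perm.mul_apply, ← zpow_one_add, add_sub_cancel, ih, shiftMap,
      sub_add_cancel] at h'
    rw [← h']
    ring_nf

theorem exists_pos_forall_dist_lt_imp_eq {X Λ : Type*} [PseudoMetricSpace X] [CompactSpace X]
    [TopologicalSpace Λ] [DiscreteTopology Λ] {f : X → Λ} (hf : Continuous f) :
    ∃ δ > 0, ∀ x y, dist x y < δ → f x = f y := by
  obtain ⟨δ, hδ, h⟩ := lebesgue_number_lemma_of_metric (s := Set.univ) isCompact_univ
    (fun a : Λ => (isOpen_discrete {a}).preimage hf) (fun x _ => Set.mem_iUnion.2 ⟨f x, rfl⟩)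
  refine ⟨δ, hδ, fun x y hxy => ?_⟩
  obtain ⟨a, ha⟩ := h x trivial
  exact (ha (Metric.mem_ball_self hδ)).trans (ha (Metric.mem_ball'.2 hxy)).symm

/-- A compact zero-dimensional metric space has a continuous finite labelling with small fibres. -/
theorem ZeroDim.exists_continuous_labelling {X : Type*} [PseudoMetricSpace X] [CompactSpace X]
    (hX : ZeroDim X) {ε : ℝ} (hε : 0 < ε) :
    ∃ (n : ℕ) (f : X → Fin n → Bool), Continuous f ∧ ∀ x y, f x = f y → dist x y < ε := by
  classical
  obtain ⟨B, hB, hbasis⟩ := hX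
  choose U hUB hxU hU using fun x : X => hbasis.exists_subset_of_mem_open
    (Metric.mem_ball_self (x := x) (half_pos hε)) Metric.isOpen_ball
  obtain ⟨t, ht⟩ := isCompact_univ.elim_finite_subcover U (fun x => (hB _ (hUB x)).isOpen)
    (fun x _ => Set.mem_iUnion.2 ⟨x, hxU x⟩)
  refine ⟨t.card, fun x i => decide (x ∈ U (t.equivFin.symm i)), ?_, fun x y hxy => ?_⟩
  · refine continuous_pi fun i => ?_
    exact continuous_bool_rng true |>.2 (by
      convert hB _ (hUB (t.equivFin.symm i : X)) using 1
      ext x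
      simp)
  · obtain ⟨z, hz, hxz⟩ := Set.mem_iUnion₂.1 (ht (Set.mem_univ x))
    have hyz : y ∈ U z := by
      have := congrFun hxy (t.equivFin ⟨z, hz⟩)
      simpa [hxz] using this
    have h₁ := Metric.mem_ball.1 (hU z hxz)
    have h₂ := Metric.mem_ball.1 (hU z hyz)
    linarith [dist_triangle_right x y z]

theorem stmt_0 {X : Type*} [MetricSpace X] [CompactSpace X] [Nonempty X] (T : X ≃ₜ X) :
    (∃ (Λ : Type) (_ : Fintype Λ) (_ : TopologicalSpace Λ) (_ : DiscreteTopology Λ)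
        (Y : Set (ℤ → Λ)),
        Y.Nonempty ∧ IsClosed Y ∧ shiftMap '' Y = Y ∧
        ∃ φ : X ≃ₜ Y, ∀ x : X, ((φ (T x) : ℤ → Λ)) = shiftMap ((φ x : ℤ → Λ))) ↔
      (ZeroDim X ∧
        ∃ ε > 0, ∀ x y : X, x ≠ y →
          ∃ n : ℤ, ε ≤ dist ((T.toEquiv ^ n) x) ((T.toEquiv ^ n) y)) := by
  constructor
  · rintro ⟨Λ, _, _, _, Y, -, -, -, φ, hφ⟩
    constructor
    · have : TotallyDisconnectedSpace X := φ.symm.totallyDisconnectedSpace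
      exact ⟨_, fun s hs => hs, isTopologicalBasis_isClopen⟩
    · obtain ⟨δ, hδ, h⟩ := exists_pos_forall_dist_lt_imp_eq
        (f := fun x => (φ x : ℤ → Λ) 0)
        ((continuous_apply 0).comp (continuous_subtype_val.comp φ.continuous))
      refine ⟨δ, hδ, fun x y hxy => ?_⟩
      contrapose! hxy
      refine φ.injective (Subtype.ext (funext fun n => ?_))
      have key := zpow_apply_of_semiconj_shiftMap T.toEquiv (fun x => (φ x : ℤ → Λ)) hφ n
      simpa [key] using h _ _ (hxy n)
  · rintro ⟨hX, ε, hε, hexp⟩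
    obtain ⟨m, f, hf, hfε⟩ := hX.exists_continuous_labelling hε
    set g : X → ℤ → Fin m → Bool := fun x n => f ((T.toEquiv ^ n) x) with hg
    have hgc : Continuous g := continuous_pi fun n => hf.comp (T.continuous_toEquiv_zpow n)
    have hgi : Function.Injective g := by
      intro x y hxy
      by_contra hne
      obtain ⟨n, hn⟩ := hexp x y hne
      exact hn.not_gt (hfε _ _ (congrFun hxy n))
    have hgT : ∀ x, g (T x) = shiftMap (g x) := fun x => by
      funext n
      simp only [hg, shiftMap, zpow_add_one, Equiv.Perm.mul_apply]
      rfl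
    have hemb := hgc.isClosedEmbedding hgi
    refine ⟨Fin m → Bool, inferInstance, inferInstance, inferInstance, Set.range g,
      Set.range_nonempty g, hemb.isClosed_range, ?_, hemb.isEmbedding.toHomeomorph, hgT⟩
    rw [← Set.range_comp, show shiftMap ∘ g = g ∘ T from funext fun x => (hgT x).symm,
      T.surjective.range_comp]
end

section
/- Let (X,T) be a topological dynamical system (X a nonempty compact metric space, T : X → X a homeomorphism) which is expansive, i.e., there is ε > 0 such that for all x ≠ y in X there is n ∈ ℤ with d(Tⁿx, Tⁿy) ≥ ε. Then (X,T) has a symbolic extension with an embedding: there exist a finite alphabet Λ, a subshift (Y,S) with Y ⊆ Λ^ℤ, a factor map π : (Y,S) → (X,T), and a Borel-measurable map ψ : X → Y such that ψ ∘ T = S ∘ ψ and π ∘ ψ = id_X. -/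
open TopologicalSpace

theorem Equiv.Perm.zpow_apply_apply {X : Type*} (f : Equiv.Perm X) (n : ℤ) (x : X) :
    (f ^ n) (f x) = (f ^ (n + 1)) x := by
  rw [zpow_add_one, Equiv.Perm.mul_apply]

/-- A finite measurable cover admits a measurable choice of an index. -/
theorem exists_measurable_index_of_cover {X : Type*} [MeasurableSpace X] {k : ℕ}
    (B : Fin k → Set X) (hB : ∀ i, MeasurableSet (B i)) (hcover : ∀ x, ∃ i, x ∈ B i) :
    ∃ c : X → Fin k, Measurable c ∧ ∀ x, x ∈ B (c x) := by
  classical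
  have hp (x : X) : ∃ n, ∃ h : n < k, x ∈ B ⟨n, h⟩ := by
    obtain ⟨i, hi⟩ := hcover x
    exact ⟨i, i.2, hi⟩
  have hmeas : Measurable fun x => Nat.find (hp x) := by
    refine measurable_find hp fun n => ?_
    by_cases h : n < k
    · simpa [h] using hB ⟨n, h⟩
    · simp [h]
  refine ⟨fun x => ⟨Nat.find (hp x), (Nat.find_spec (hp x)).1⟩, ?_,
    fun x => (Nat.find_spec (hp x)).2⟩
  refine measurable_to_countable' fun i => ?_
  have : (fun x => (⟨Nat.find (hp x), (Nat.find_spec (hp x)).1⟩ : Fin k)) ⁻¹' {i} =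
      (fun x => Nat.find (hp x)) ⁻¹' {(i : ℕ)} := by
    ext x
    simp [Fin.ext_iff]
  rw [this]
  exact hmeas (measurableSet_singleton _)

/-- A compact metric space is covered by finitely many closed balls of a given radius. -/
theorem exists_fin_closedBall_cover (X : Type*) [MetricSpace X] [CompactSpace X] {r : ℝ}
    (hr : 0 < r) : ∃ (k : ℕ) (p : Fin k → X), ∀ x, ∃ i, x ∈ Metric.closedBall (p i) r := by
  obtain ⟨t, -, htf, ht⟩ := finite_cover_balls_of_compact (isCompact_univ (X := X)) hr
  obtain ⟨k, p, -, rfl⟩ := htf.fin_param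
  refine ⟨k, p, fun x => ?_⟩
  obtain ⟨_, ⟨i, rfl⟩, hi⟩ := Set.mem_iUnion₂.1 (ht (Set.mem_univ x))
  exact ⟨i, Metric.ball_subset_closedBall hi⟩

theorem stmt_1 {X : Type*} [MetricSpace X] [CompactSpace X] [Nonempty X] (T : X ≃ₜ X)
    (hexp : ∃ ε > 0, ∀ x y : X, x ≠ y →
      ∃ n : ℤ, ε ≤ dist ((T.toEquiv ^ n) x) ((T.toEquiv ^ n) y)) :
    ∃ (Λ : Type) (_ : Fintype Λ) (_ : TopologicalSpace Λ) (_ : DiscreteTopology Λ)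
      (Y : Set (ℤ → Λ)),
      Y.Nonempty ∧ IsClosed Y ∧ shiftMap '' Y = Y ∧
      ∃ (S : Y → Y) (π : Y → X) (ψ : X → Y),
        (∀ y : Y, (S y : ℤ → Λ) = shiftMap (y : ℤ → Λ)) ∧
        Continuous π ∧ Function.Surjective π ∧ (∀ y : Y, π (S y) = T (π y)) ∧
        @Measurable X Y (borel X) (borel Y) ψ ∧
        (∀ x : X, ψ (T x) = S (ψ x)) ∧ (∀ x : X, π (ψ x) = x) := by
  obtain ⟨ε, hε, hexp⟩ := hexp
  obtain ⟨k, p, hp⟩ := exists_fin_closedBall_cover X (show 0 < ε / 3 by positivity)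
  let _ : MeasurableSpace X := borel X
  have : BorelSpace X := ⟨rfl⟩
  obtain ⟨c, hc, hcB⟩ := exists_measurable_index_of_cover
    (fun i => Metric.closedBall (p i) (ε / 3))
    (fun i => Metric.isClosed_closedBall.measurableSet) hp
  let G : Set (X × (ℤ → Fin k)) :=
    {q | ∀ n : ℤ, (T.toEquiv ^ n) q.1 ∈ Metric.closedBall (p (q.2 n)) (ε / 3)}
  have hG : IsClosed G := by
    simp only [G, Set.ofPred_forall, Metric.mem_closedBall]
    refine isClosed_iInter fun n => isClosed_le ?_ continuous_const
    refine ((T.continuous_toEquiv_zpow n).comp continuous_fst).dist ?_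
    exact (continuous_of_discreteTopology (f := p)).comp
      ((continuous_apply n).comp continuous_snd)
  have hGuniq {x x' : X} {y : ℤ → Fin k} (h : (x, y) ∈ G) (h' : (x', y) ∈ G) : x = x' := by
    by_contra hne
    obtain ⟨n, hn⟩ := hexp x x' hne
    have h1 := Metric.mem_closedBall.1 (h n)
    have h2 := Metric.mem_closedBall.1 (h' n)
    have h3 := dist_triangle_right ((T.toEquiv ^ n) x) ((T.toEquiv ^ n) x') (p (y n))
    simp only at h1 h2
    linarith
  have hGshift {x : X} {y : ℤ → Fin k} (h : (x, y) ∈ G) : (T x, shiftMap y) ∈ G := by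
    intro n
    have := h (n + 1)
    rwa [← Equiv.Perm.zpow_apply_apply] at this
  have hGunshift {x : X} {y : ℤ → Fin k} (h : (x, y) ∈ G) :
      (T.symm x, fun n => y (n - 1)) ∈ G := by
    intro n
    have := h (n - 1)
    have e : (T.toEquiv ^ (n - 1)) x = (T.toEquiv ^ n) (T.symm x) := by
      rw [zpow_sub_one, Equiv.Perm.mul_apply]
      rfl
    simpa [← e] using this
  let code : X → ℤ → Fin k := fun x n => c ((T.toEquiv ^ n) x)
  have hcode (x : X) : (x, code x) ∈ G := fun n => hcB _
  let Y : Set (ℤ → Fin k) := Prod.snd '' G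
  have hY {y : ℤ → Fin k} : y ∈ Y ↔ ∃ x, (x, y) ∈ G := by simp [Y]
  choose f hf using fun y : Y => hY.1 y.2
  have hS (y : Y) : shiftMap (y : ℤ → Fin k) ∈ Y := hY.2 ⟨_, hGshift (hf y)⟩
  refine ⟨Fin k, inferInstance, inferInstance, inferInstance, Y, ?_, ?_, ?_,
    fun y => ⟨_, hS y⟩, f, fun x => ⟨code x, hY.2 ⟨x, hcode x⟩⟩, fun _ => rfl, ?_,
    fun x => ⟨⟨code x, hY.2 ⟨x, hcode x⟩⟩, hGuniq (hf _) (hcode x)⟩,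
    fun y => hGuniq (hf _) (hGshift (hf y)), ?_, ?_, fun x => hGuniq (hf _) (hcode x)⟩
  · exact ⟨_, hY.2 ⟨_, hcode (Classical.arbitrary X)⟩⟩
  · exact isClosedMap_snd_of_compactSpace _ hG
  · refine Set.Subset.antisymm (Set.image_subset_iff.2 fun y hy => hS ⟨y, hy⟩) fun y hy => ?_
    refine ⟨fun n => y (n - 1), hY.2 ⟨_, hGunshift (hf ⟨y, hy⟩)⟩, ?_⟩
    funext n
    simp [shiftMap]
  · refine continuous_iff_isClosed.2 fun s hs => ?_
    have hpre : f ⁻¹' s = Subtype.val ⁻¹' (Prod.snd '' (G ∩ Prod.fst ⁻¹' s)) := by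
      ext y
      constructor
      · exact fun h => ⟨(f y, y), ⟨hf y, h⟩, rfl⟩
      · rintro ⟨⟨x, z⟩, ⟨hG', hx⟩, rfl : z = y⟩
        exact Set.mem_preimage.2 (hGuniq hG' (hf y) ▸ hx)
    rw [hpre]
    exact (isClosedMap_snd_of_compactSpace _
      (hG.inter (hs.preimage continuous_fst))).preimage continuous_subtype_val
  · rw [← BorelSpace.measurable_eq (α := Y)]
    refine Measurable.subtype_mk (measurable_pi_lambda _ fun n => ?_)
    exact hc.comp (T.continuous_toEquiv_zpow n).measurable
  · intro x
    refine Subtype.ext (funext fun n => ?_)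
    exact congrArg c (Equiv.Perm.zpow_apply_apply T.toEquiv n x)
end

section
/- Let (X,T) be a topological dynamical system (X a nonempty compact metric space, T : X → X a homeomorphism). Then (X,T) has a uniform generator—i.e., a finite Borel-measurable partition P of X such that the maximal diameter of the atoms of Pⁿ = ⋁_{|i|<n} T^{-i}(P) tends to 0 as n → ∞—if and only if (X,T) has a symbolic extension with an embedding, i.e., there exist a finite alphabet Λ, a subshift (Y,S) with Y ⊆ Λ^ℤ, a factor map π : (Y,S) → (X,T), and a Borel-measurable map ψ : X → Y with ψ ∘ T = S ∘ ψ and π ∘ ψ = id_X. -/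
open TopologicalSpace

/-- The atom of the partition `⋁_{|i|<n} T^{-i} P` determined by the itinerary `f`. -/
def refinedAtom {X : Type*} [TopologicalSpace X] {ι : Type*} (T : X ≃ₜ X) (P : ι → Set X) (n : ℕ) (f : ℤ → ι) :
    Set X :=
  {x : X | ∀ i : ℤ, |i| < (n : ℤ) → (T.toEquiv ^ i) x ∈ P (f i)}

/-- A uniform generator: a finite Borel partition whose refinements have diameters tending
to zero. -/
def IsUniformGenerator {X : Type*} [MetricSpace X] (T : X ≃ₜ X) {ι : Type}
    (P : ι → Set X) : Prop :=
  (∀ i, @MeasurableSet X (borel X) (P i)) ∧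
  Pairwise (Function.onFun Disjoint P) ∧ (⋃ i, P i) = Set.univ ∧
  ∀ ε > (0 : ℝ), ∃ N : ℕ, ∀ n ≥ N, ∀ f : ℤ → ι,
    Metric.diam (refinedAtom T P n f) ≤ ε

open Set

theorem toEquiv_zpow_add_one_apply {X : Type*} [TopologicalSpace X] (T : X ≃ₜ X) (i : ℤ) (x : X) :
    (T.toEquiv ^ (i + 1)) x = T ((T.toEquiv ^ i) x) := by
  rw [add_comm, zpow_add, zpow_one]; rfl

theorem toEquiv_zpow_apply_self {X : Type*} [TopologicalSpace X] (T : X ≃ₜ X) (i : ℤ) (x : X) :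
    (T.toEquiv ^ i) (T x) = (T.toEquiv ^ (i + 1)) x := by
  rw [zpow_add, zpow_one]; rfl

/-- The shift on bi-infinite sequences as a homeomorphism. -/
def shiftHomeomorph (Λ : Type*) [TopologicalSpace Λ] : (ℤ → Λ) ≃ₜ (ℤ → Λ) where
  toFun := shiftMap
  invFun x := fun n => x (n - 1)
  left_inv x := by ext n; simp [shiftMap]
  right_inv x := by ext n; simp [shiftMap]
  continuous_toFun := by unfold shiftMap; fun_prop
  continuous_invFun := by fun_prop

theorem borel_eq_comap_pi {Λ : Type*} [Countable Λ] [TopologicalSpace Λ] [DiscreteTopology Λ]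
    (Y : Set (ℤ → Λ)) :
    borel Y = MeasurableSpace.comap Subtype.val (@MeasurableSpace.pi ℤ (fun _ => Λ) fun _ => ⊤) := by
  let : MeasurableSpace Λ := ⊤
  have : BorelSpace Λ := ⟨borel_eq_top_of_discrete.symm⟩
  exact (BorelSpace.measurable_eq (α := Y)).symm

/-- A continuous map on a closed set of sequences over a finite alphabet is uniformly determined
by finitely many coordinates. -/
theorem exists_forall_agree_dist_lt {X Λ : Type*} [MetricSpace X] [Finite Λ] [TopologicalSpace Λ]
    [DiscreteTopology Λ] {Y : Set (ℤ → Λ)} (hY : IsClosed Y) {π : Y → X} (hπ : Continuous π)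
    {ε : ℝ} (hε : 0 < ε) :
    ∃ N : ℕ, ∀ y z : Y, (∀ i : ℤ, |i| < (N : ℤ) → y.1 i = z.1 i) → dist (π y) (π z) < ε := by
  have : CompactSpace Y := isCompact_iff_compactSpace.mp hY.isCompact
  have hK : IsCompact {p : Y × Y | ε ≤ dist (π p.1) (π p.2)} :=
    (isClosed_le continuous_const (by fun_prop)).isCompact
  obtain ⟨N, hN⟩ := hK.elim_directed_cover
    (fun n : ℕ => ⋃ i : ℤ, ⋃ _ : |i| < (n : ℤ), {p : Y × Y | p.1.1 i ≠ p.2.1 i})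
    (fun n => isOpen_iUnion fun i => isOpen_iUnion fun _ => by
      have h : Continuous fun p : Y × Y => (p.1.1 i, p.2.1 i) :=
        ((continuous_apply i).comp (continuous_subtype_val.comp continuous_fst)).prodMk
          ((continuous_apply i).comp (continuous_subtype_val.comp continuous_snd))
      exact (isOpen_discrete {q : Λ × Λ | q.1 ≠ q.2}).preimage h)
    (by
      rintro ⟨y, z⟩ hp
      have hne : y.1 ≠ z.1 := by
        intro h
        have hyz : y = z := Subtype.ext h
        subst hyz
        simp only [mem_ofPred_eq, dist_self] at hp
        linarith
      obtain ⟨i, hi⟩ := Function.ne_iff.mp hne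
      simp only [mem_iUnion]
      exact ⟨i.natAbs + 1, i, by push_cast; omega, hi⟩)
    (by
      refine Monotone.directed_le fun m n hmn p hp => ?_
      simp only [mem_iUnion] at hp ⊢
      obtain ⟨i, hi, h⟩ := hp
      exact ⟨i, hi.trans_le (by exact_mod_cast hmn), h⟩)
  refine ⟨N, fun y z h => ?_⟩
  by_contra! hc
  have hp := hN (show (y, z) ∈ _ from hc)
  simp only [mem_iUnion] at hp
  obtain ⟨i, hi, hne⟩ := hp
  exact hne (h i hi)

theorem exists_symbolicExtension_of_isUniformGenerator {X : Type*} [MetricSpace X] [CompactSpace X]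
    [Nonempty X] (T : X ≃ₜ X) {ι : Type} [Finite ι] [TopologicalSpace ι] [DiscreteTopology ι]
    {P : ι → Set X} (hP : IsUniformGenerator T P) :
    ∃ Y : Set (ℤ → ι), Y.Nonempty ∧ IsClosed Y ∧ shiftMap '' Y = Y ∧
      ∃ (S : Y → Y) (π : Y → X) (ψ : X → Y),
        (∀ y : Y, (S y : ℤ → ι) = shiftMap (y : ℤ → ι)) ∧
        Continuous π ∧ Function.Surjective π ∧ (∀ y : Y, π (S y) = T (π y)) ∧
        @Measurable X Y (borel X) (borel Y) ψ ∧
        (∀ x : X, ψ (T x) = S (ψ x)) ∧ (∀ x : X, π (ψ x) = x) := by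
  obtain ⟨hmeas, hdisj, hcover, hdiam⟩ := hP
  have hex : ∀ x, ∃ a, x ∈ P a := fun x => mem_iUnion.mp (hcover ▸ mem_univ x)
  choose c hc using hex
  have hcu : ∀ {x a}, x ∈ P a → c x = a := by
    intro x a hx
    by_contra hne
    exact (hdisj hne).le_bot ⟨hc x, hx⟩
  let φ : X → ℤ → ι := fun x i => c ((T.toEquiv ^ i) x)
  have hφT : ∀ x, φ (T x) = shiftMap (φ x) := fun x => by
    funext i
    simp only [φ, shiftMap, toEquiv_zpow_apply_self]
  have hφmem : ∀ x n, x ∈ refinedAtom T P n (φ x) := fun x n i _ => hc _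
  let Y : Set (ℤ → ι) := closure (range φ)
  have hshift : shiftMap '' Y = Y := by
    have h := (shiftHomeomorph ι).image_closure (range φ)
    change shiftMap '' Y = closure (shiftMap '' range φ) at h
    rw [h, ← range_comp]
    have : shiftMap ∘ φ = φ ∘ T := funext fun x => (hφT x).symm
    rw [this, T.surjective.range_comp]
  have hanti : ∀ (f : ℤ → ι) {m n : ℕ}, m ≤ n → refinedAtom T P n f ⊆ refinedAtom T P m f :=
    fun f m n hmn x hx i hi => hx i (hi.trans_le (by exact_mod_cast hmn))
  have hcongr : ∀ {f g : ℤ → ι} {n : ℕ}, (∀ i : ℤ, |i| < (n : ℤ) → f i = g i) →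
      refinedAtom T P n f = refinedAtom T P n g := fun {f g n} h => by
    ext x
    exact forall₂_congr fun i hi => by rw [h i hi]
  have hopen : ∀ (f : ℤ → ι) (n : ℕ), IsOpen {g : ℤ → ι | ∀ i : ℤ, |i| < (n : ℤ) → f i = g i} := by
    intro f n
    have hfin : {i : ℤ | |i| < (n : ℤ)}.Finite :=
      (finite_Ioo (-(n : ℤ)) n).subset fun i hi => abs_lt.mp hi
    have := isOpen_set_pi (s := fun i => {f i}) hfin fun i _ => isOpen_discrete _
    convert this using 1
    ext g
    exact forall₂_congr fun i _ => eq_comm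
  have hnonempty : ∀ y ∈ Y, ∀ n, (refinedAtom T P n y).Nonempty := by
    intro y hy n
    obtain ⟨_, h, x, rfl⟩ := mem_closure_iff.mp hy _ (hopen y n) fun _ _ => rfl
    exact ⟨x, hcongr h ▸ hφmem x n⟩
  have hpoint : ∀ y : Y, ∃ x, ∀ n, x ∈ closure (refinedAtom T P n y.1) := by
    intro y
    obtain ⟨x, hx⟩ := IsCompact.nonempty_iInter_of_sequence_nonempty_isCompact_isClosed
      (fun n => closure (refinedAtom T P n y.1)) (fun n => closure_mono (hanti _ n.le_succ))
      (fun n => (hnonempty y.1 y.2 n).closure) isClosed_closure.isCompact fun _ => isClosed_closure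
    exact ⟨x, mem_iInter.mp hx⟩
  choose π hπ using hpoint
  have hclose : ∀ ε > (0 : ℝ), ∃ N : ℕ, ∀ f, ∀ x ∈ closure (refinedAtom T P N f),
      ∀ z ∈ closure (refinedAtom T P N f), dist x z ≤ ε := by
    intro ε hε
    obtain ⟨N, hN⟩ := hdiam ε hε
    refine ⟨N, fun f x hx z hz => ?_⟩
    have hb := Metric.dist_le_diam_of_mem (isClosed_closure.isCompact.isBounded) hx hz
    rw [Metric.diam_closure] at hb
    exact hb.trans (hN N le_rfl f)
  have huniq : ∀ (y : Y) x, (∀ n, x ∈ closure (refinedAtom T P n y.1)) → π y = x := by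
    intro y x hx
    refine eq_of_forall_dist_le fun ε hε => ?_
    obtain ⟨N, hN⟩ := hclose ε hε
    exact hN y.1 _ (hπ y N) _ (hx N)
  let S : Y → Y := fun y => ⟨shiftMap y.1, hshift.subset (mem_image_of_mem _ y.2)⟩
  let ψ : X → Y := fun x => ⟨φ x, subset_closure (mem_range_self x)⟩
  have hπψ : ∀ x, π (ψ x) = x := fun x => huniq _ _ fun n => subset_closure (hφmem x n)
  refine ⟨Y, (range_nonempty φ).closure, isClosed_closure, hshift, S, π, ψ, fun _ => rfl, ?_,
    fun x => ⟨ψ x, hπψ x⟩, ?_, ?_, fun x => Subtype.ext (hφT x), hπψ⟩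
  · refine Metric.continuous_iff'.mpr fun y ε hε => ?_
    obtain ⟨N, hN⟩ := hclose (ε / 2) (half_pos hε)
    filter_upwards [((hopen y.1 N).preimage continuous_subtype_val).mem_nhds
      (show y ∈ _ from fun _ _ => rfl)] with z hz
    have h := hN y.1 (π z) (by rw [hcongr hz]; exact hπ z N) (π y) (hπ y N)
    linarith
  · intro y
    refine huniq _ _ fun n => ?_
    have hmaps : MapsTo T (refinedAtom T P (n + 1) y.1) (refinedAtom T P n (shiftMap y.1)) := by
      intro x hx i hi
      rw [toEquiv_zpow_apply_self]
      exact hx (i + 1) (by push_cast; rw [abs_lt] at hi ⊢; omega)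
    exact hmaps.closure T.continuous (hπ y (n + 1))
  · let : MeasurableSpace X := borel X
    have : BorelSpace X := ⟨rfl⟩
    let : MeasurableSpace ι := ⊤
    rw [borel_eq_comap_pi]
    have hcm : Measurable c := measurable_to_countable' fun a => by
      have : c ⁻¹' {a} = P a := by
        ext x
        exact ⟨fun h => (show c x = a from h) ▸ hc x, hcu⟩
      rw [this]
      exact hmeas a
    have hTi : ∀ i : ℤ, Measurable fun x => (T.toEquiv ^ i) x := by
      intro i
      induction i using Int.induction_on with
      | zero => exact measurable_id
      | succ k ih =>
        simp only [toEquiv_zpow_add_one_apply]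
        exact T.measurable.comp ih
      | pred k ih =>
        have : (fun x => (T.toEquiv ^ (-(k : ℤ) - 1)) x) =
            fun x => T.symm ((T.toEquiv ^ (-(k : ℤ))) x) := by
          funext x
          rw [Homeomorph.eq_symm_apply, ← toEquiv_zpow_add_one_apply, sub_add_cancel]
        rw [this]
        exact T.symm.measurable.comp ih
    exact Measurable.subtype_mk (measurable_pi_lambda _ fun i => hcm.comp (hTi i))

theorem exists_isUniformGenerator_of_symbolicExtension {X : Type*} [MetricSpace X]
    (T : X ≃ₜ X) {Λ : Type} [Finite Λ] [TopologicalSpace Λ] [DiscreteTopology Λ]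
    {Y : Set (ℤ → Λ)} (hY : IsClosed Y) {S : Y → Y} {π : Y → X} {ψ : X → Y}
    (hS : ∀ y : Y, (S y : ℤ → Λ) = shiftMap (y : ℤ → Λ)) (hπ : Continuous π)
    (hψ : @Measurable X Y (borel X) (borel Y) ψ) (hψT : ∀ x : X, ψ (T x) = S (ψ x))
    (hπψ : ∀ x : X, π (ψ x) = x) :
    IsUniformGenerator T fun a : Λ => {x | (ψ x).1 0 = a} := by
  have hcoord : ∀ (i n : ℤ) (x : X), (ψ ((T.toEquiv ^ i) x)).1 n = (ψ x).1 (n + i) := by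
    have hstep : ∀ (n : ℤ) (x : X), (ψ (T x)).1 n = (ψ x).1 (n + 1) := fun n x => by
      rw [hψT, hS]; rfl
    intro i
    induction i using Int.induction_on with
    | zero => intro n x; simp
    | succ k ih =>
      intro n x
      rw [toEquiv_zpow_add_one_apply, hstep, ih]
      exact congrArg (ψ x).1 (by ring)
    | pred k ih =>
      intro n x
      have h := hstep (n - 1) ((T.toEquiv ^ (-(k : ℤ) - 1)) x)
      rw [← toEquiv_zpow_add_one_apply, sub_add_cancel, sub_add_cancel, ih] at h
      rw [← h]
      exact congrArg (ψ x).1 (by ring)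
  refine ⟨fun a => ?_, fun a b hab => ?_, ?_, fun ε hε => ?_⟩
  · have hopen : IsOpen {y : Y | y.1 0 = a} :=
      (isOpen_discrete {a}).preimage
        (show Continuous fun y : Y => y.1 0 from
          (continuous_apply (0 : ℤ)).comp continuous_subtype_val)
    exact hψ (MeasurableSpace.measurableSet_generateFrom hopen)
  · exact disjoint_left.mpr fun x hx hx' => hab (hx.symm.trans hx')
  · exact eq_univ_of_forall fun x => mem_iUnion.mpr ⟨_, rfl⟩
  · obtain ⟨N, hN⟩ := exists_forall_agree_dist_lt hY hπ hε
    refine ⟨N, fun n hn f => Metric.diam_le_of_forall_dist_le hε.le fun x hx z hz => ?_⟩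
    rw [← hπψ x, ← hπψ z]
    refine (hN _ _ fun i hi => ?_).le
    have hin : |i| < (n : ℤ) := hi.trans_le (by exact_mod_cast hn)
    have hxi : (ψ ((T.toEquiv ^ i) x)).1 0 = f i := hx i hin
    have hzi : (ψ ((T.toEquiv ^ i) z)).1 0 = f i := hz i hin
    rw [hcoord, zero_add] at hxi hzi
    rw [hxi, hzi]

theorem stmt_2 {X : Type*} [MetricSpace X] [CompactSpace X] [Nonempty X] (T : X ≃ₜ X) :
    (∃ (ι : Type) (_ : Fintype ι) (P : ι → Set X), IsUniformGenerator T P) ↔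
    (∃ (Λ : Type) (_ : Fintype Λ) (_ : TopologicalSpace Λ) (_ : DiscreteTopology Λ)
      (Y : Set (ℤ → Λ)),
      Y.Nonempty ∧ IsClosed Y ∧ shiftMap '' Y = Y ∧
      ∃ (S : Y → Y) (π : Y → X) (ψ : X → Y),
        (∀ y : Y, (S y : ℤ → Λ) = shiftMap (y : ℤ → Λ)) ∧
        Continuous π ∧ Function.Surjective π ∧ (∀ y : Y, π (S y) = T (π y)) ∧
        @Measurable X Y (borel X) (borel Y) ψ ∧
        (∀ x : X, ψ (T x) = S (ψ x)) ∧ (∀ x : X, π (ψ x) = x)) := by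
  constructor
  · rintro ⟨ι, hι, P, hP⟩
    let : TopologicalSpace ι := ⊥
    have : DiscreteTopology ι := ⟨rfl⟩
    exact ⟨ι, hι, ⊥, ⟨rfl⟩, exists_symbolicExtension_of_isUniformGenerator T hP⟩
  · rintro ⟨Λ, hΛ, _, _, Y, -, hY, -, S, π, ψ, hS, hπ, -, -, hψ, hψT, hπψ⟩
    exact ⟨Λ, hΛ, _, exists_isUniformGenerator_of_symbolicExtension T hY hS hπ hψ hψT hπψ⟩
end

section
/- Let (X,T) be a topological dynamical system (X a nonempty compact metric space, T : X → X a homeomorphism) with the small boundary property: there exists a basis of the topology of X consisting of open sets U whose boundaries ∂U satisfy μ(∂U) = 0 for every T-invariant Borel probability measure μ on X. Then (X,T) admits an isomorphic zero-dimensional extension: there exist a zero-dimensional topological dynamical system (X',T') and a factor map π : (X',T') → (X,T) such that (i) the pushforward map ν ↦ π_*ν is a bijection from the set of T'-invariant Borel probability measures on X' onto the set of T-invariant Borel probability measures on X, and (ii) for every T'-invariant Borel probability measure ν on X' there is a Borel set B ⊆ X' with ν(B) = 1 on which π is injective (so π is a measure-theoretic isomorphism between (X',ν,T') and (X,π_*ν,T)).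 -/
open TopologicalSpace MeasureTheory

/-- `μ` is an invariant Borel probability measure for `f`. -/
def InvProb {Z : Type*} [MeasurableSpace Z] (f : Z → Z) (μ : Measure Z) : Prop :=
  IsProbabilityMeasure μ ∧ ∀ A : Set Z, MeasurableSet A → μ (f ⁻¹' A) = μ A

section SymbolicExtension

variable {X ι : Type*} [TopologicalSpace X]

/-- The point `x` and the itinerary `c` are compatible with the family `U`: if `c i` is true then
`x` lies in the closure of `U i`, otherwise `x` lies outside `U i`. -/
def Codes (U : ι → Set X) (x : X) (c : ι → Bool) : Prop :=
  ∀ i, (c i = true → x ∈ closure (U i)) ∧ (c i = false → x ∉ U i)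

/-- The itineraries compatible with some point. -/
def codeSpace (U : ι → Set X) : Set (ι → Bool) := {c | ∃ x, Codes U x c}

/-- The point coded by an itinerary. -/
noncomputable def codedPoint (U : ι → Set X) (c : codeSpace U) : X := c.2.choose

theorem codes_codedPoint (U : ι → Set X) (c : codeSpace U) : Codes U (codedPoint U c) c :=
  c.2.choose_spec

/-- The canonical itinerary of a point. -/
noncomputable def itinerary (U : ι → Set X) (x : X) : ι → Bool :=
  open Classical in fun i => decide (x ∈ U i)

theorem codes_itinerary (U : ι → Set X) (x : X) : Codes U x (itinerary U x) :=
  fun i => ⟨fun h => subset_closure (by simpa [itinerary] using h),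
    fun h => by simpa [itinerary] using h⟩

/-- The canonical itinerary as an element of the code space. -/
noncomputable def itineraryCode (U : ι → Set X) (x : X) : codeSpace U :=
  ⟨itinerary U x, x, codes_itinerary U x⟩

theorem isClosed_codes {U : ι → Set X} (hU : ∀ i, IsOpen (U i)) :
    IsClosed {p : X × (ι → Bool) | Codes U p.1 p.2} := by
  simp only [Codes, Set.ofPred_forall, Set.ofPred_and]
  have hc : ∀ (i : ι) (b : Bool), IsOpen {p : X × (ι → Bool) | p.2 i = b} := fun i b =>
    (isOpen_discrete {b}).preimage (f := fun p : X × (ι → Bool) => p.2 i) (by fun_prop)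
  refine isClosed_iInter fun i => IsClosed.inter ?_ ?_
  · exact isClosed_imp (hc i true) (isClosed_closure.preimage continuous_fst)
  · exact isClosed_imp (hc i false) ((hU i).isClosed_compl.preimage continuous_fst)

theorem isClosed_codeSpace [CompactSpace X] {U : ι → Set X} (hU : ∀ i, IsOpen (U i)) :
    IsClosed (codeSpace U) := by
  convert isClosedMap_snd_of_compactSpace _ (isClosed_codes hU)
  ext c
  simp [codeSpace]

theorem Codes.unique {U : ι → Set X} (hsep : ∀ x y, x ≠ y → ∃ i, x ∈ U i ∧ y ∉ closure (U i))
    {x y : X} {c : ι → Bool} (hx : Codes U x c) (hy : Codes U y c) : x = y := by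
  by_contra hne
  obtain ⟨i, hxi, hyi⟩ := hsep x y hne
  cases hb : c i
  · exact (hx i).2 hb hxi
  · exact hyi ((hy i).1 hb)

theorem codedPoint_eq {U : ι → Set X} (hsep : ∀ x y, x ≠ y → ∃ i, x ∈ U i ∧ y ∉ closure (U i))
    {x : X} {c : codeSpace U} (hx : Codes U x c) : codedPoint U c = x :=
  (codes_codedPoint U c).unique hsep hx

theorem continuous_codedPoint [CompactSpace X] {U : ι → Set X} (hU : ∀ i, IsOpen (U i))
    (hsep : ∀ x y, x ≠ y → ∃ i, x ∈ U i ∧ y ∉ closure (U i)) :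
    Continuous (codedPoint U) := by
  refine continuous_iff_isClosed.2 fun F hF => ?_
  have h := (isClosedMap_snd_of_compactSpace _
    ((isClosed_codes hU).inter (hF.preimage continuous_fst))).preimage
      (continuous_subtype_val (p := (· ∈ codeSpace U)))
  convert h
  ext c
  constructor
  · exact fun hc => ⟨(codedPoint U c, c), ⟨codes_codedPoint U c, hc⟩, rfl⟩
  · rintro ⟨⟨x, d⟩, ⟨hx, hxF⟩, rfl : d = c⟩
    rw [Set.mem_preimage, codedPoint_eq hsep hx]
    exact hxF

theorem Codes.eq_itinerary {U : ι → Set X} (hU : ∀ i, IsOpen (U i)) {x : X} {c : ι → Bool}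
    (hx : Codes U x c) (hfr : ∀ i, x ∉ frontier (U i)) : c = itinerary U x := by
  funext i
  have hi := hfr i
  rw [(hU i).frontier_eq, Set.mem_sdiff, not_and_not_right] at hi
  cases hb : c i
  · simpa [itinerary] using (hx i).2 hb
  · simpa [itinerary] using hi ((hx i).1 hb)

theorem measurable_itineraryCode [Countable ι] [MeasurableSpace X] [BorelSpace X]
    {U : ι → Set X} (hU : ∀ i, IsOpen (U i)) : Measurable (itineraryCode U) := by
  refine Measurable.subtype_mk (measurable_pi_lambda _ fun i => measurable_to_bool ?_)
  convert (hU i).measurableSet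
  ext x
  simp [itinerary]

theorem zeroDim_of_isClosed {S : Set (ι → Bool)} (hS : IsClosed S) : ZeroDim S :=
  have := isCompact_iff_compactSpace.1 hS.isCompact
  ⟨_, fun _ hs => hs, isTopologicalBasis_isClopen⟩

theorem Codes.shift {U : ι → Set X} {T : X ≃ₜ X} {σ : ι ≃ ι} (hσ : ∀ i, U (σ i) = T ⁻¹' U i)
    {x : X} {c : ι → Bool} (hx : Codes U x c) : Codes U (T x) (fun i => c (σ i)) := fun i => by
  have := hx (σ i)
  rwa [hσ, ← T.preimage_closure] at this

/-- The shift induced on the code space by a permutation of the indices which is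
equivariant with respect to a homeomorphism. -/
def codeShift {U : ι → Set X} {T : X ≃ₜ X} {σ : ι ≃ ι} (hσ : ∀ i, U (σ i) = T ⁻¹' U i) :
    codeSpace U ≃ₜ codeSpace U where
  toFun c := ⟨fun i => c.1 (σ i), by
    obtain ⟨x, hx⟩ := c.2
    exact ⟨T x, hx.shift hσ⟩⟩
  invFun c := ⟨fun i => c.1 (σ.symm i), by
    obtain ⟨x, hx⟩ := c.2
    refine ⟨T.symm x, fun i => ?_⟩
    have := hx (σ.symm i)
    obtain ⟨j, rfl⟩ := σ.surjective i
    simpa [hσ, ← T.preimage_closure] using this⟩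
  left_inv c := by simp
  right_inv c := by simp
  continuous_toFun := by
    refine Continuous.subtype_mk (continuous_pi fun i => ?_) _
    exact (continuous_apply (σ i)).comp continuous_subtype_val
  continuous_invFun := by
    refine Continuous.subtype_mk (continuous_pi fun i => ?_) _
    exact (continuous_apply (σ.symm i)).comp continuous_subtype_val

theorem itineraryCode_apply {U : ι → Set X} {T : X ≃ₜ X} {σ : ι ≃ ι}
    (hσ : ∀ i, U (σ i) = T ⁻¹' U i) (x : X) :
    itineraryCode U (T x) = codeShift hσ (itineraryCode U x) := by
  ext i
  simp [itineraryCode, codeShift, itinerary, hσ]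

end SymbolicExtension

theorem InvProb.map {Y Z : Type*} [MeasurableSpace Y] [MeasurableSpace Z] {f : Y → Y} {g : Z → Z}
    {φ : Y → Z} (hφ : Measurable φ) (hg : Measurable g) (h : ∀ y, φ (f y) = g (φ y))
    {μ : Measure Y} (hμ : InvProb f μ) : InvProb g (μ.map φ) := by
  have := hμ.1
  refine ⟨Measure.isProbabilityMeasure_map hφ.aemeasurable, fun A hA => ?_⟩
  rw [Measure.map_apply hφ (hg hA), Measure.map_apply hφ hA, ← hμ.2 _ (hφ hA)]
  congr 1
  ext y
  simp [h]

theorem InvProb.measure_preimage_zpow {X : Type*} [TopologicalSpace X] [MeasurableSpace X]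
    [BorelSpace X] {T : X ≃ₜ X} {μ : Measure X} (hμ : InvProb T μ) (k : ℤ) {A : Set X}
    (hA : MeasurableSet A) : μ ((T ^ k : X ≃ₜ X) ⁻¹' A) = μ A := by
  induction k with
  | zero =>
    rw [zpow_zero]
    rfl
  | succ n ih =>
    rw [← ih, ← hμ.2 _ ((T ^ (n : ℤ) : X ≃ₜ X).measurable hA), zpow_add_one]
    rfl
  | pred n ih =>
    rw [← ih, ← hμ.2 _ ((T ^ (-(n : ℤ) - 1) : X ≃ₜ X).measurable hA)]
    conv_rhs => rw [← sub_add_cancel (-(n : ℤ)) 1, zpow_add_one]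
    rfl

/-- A countable equivariant family of open sets with universally null boundaries which separates
points yields an isomorphic symbolic extension. -/
theorem codedPoint_isomorphic {X ι : Type*} [TopologicalSpace X] [CompactSpace X]
    [MeasurableSpace X] [BorelSpace X] [Countable ι] {U : ι → Set X} {T : X ≃ₜ X} {σ : ι ≃ ι}
    (hσ : ∀ i, U (σ i) = T ⁻¹' U i) (hU : ∀ i, IsOpen (U i))
    (hsep : ∀ x y, x ≠ y → ∃ i, x ∈ U i ∧ y ∉ closure (U i))
    (hnull : ∀ μ : Measure X, InvProb T μ → ∀ i, μ (frontier (U i)) = 0) :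
    Set.BijOn (Measure.map (codedPoint U))
        {ν : Measure (codeSpace U) | InvProb (codeShift hσ) ν} {μ : Measure X | InvProb T μ} ∧
      ∀ ν : Measure (codeSpace U), InvProb (codeShift hσ) ν →
        ∃ B : Set (codeSpace U), MeasurableSet B ∧ ν B = 1 ∧ Set.InjOn (codedPoint U) B := by
  have hπ : Measurable (codedPoint U) := (continuous_codedPoint hU hsep).measurable
  have hs := measurable_itineraryCode hU
  have hπT : ∀ c, codedPoint U (codeShift hσ c) = T (codedPoint U c) := fun c =>
    codedPoint_eq hsep ((codes_codedPoint U c).shift hσ)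
  have hmap : ∀ ν : Measure (codeSpace U), InvProb (codeShift hσ) ν →
      InvProb T (ν.map (codedPoint U)) := fun ν hν => hν.map hπ T.measurable hπT
  have hsec : ∀ c, (∀ i, codedPoint U c ∉ frontier (U i)) →
      itineraryCode U (codedPoint U c) = c := fun c hc =>
    Subtype.ext ((codes_codedPoint U c).eq_itinerary hU hc).symm
  have hae : ∀ ν : Measure (codeSpace U), InvProb (codeShift hσ) ν →
      ∀ᵐ c ∂ν, ∀ i, codedPoint U c ∉ frontier (U i) := fun ν hν => ae_all_iff.2 fun i => by
    have := hnull _ (hmap ν hν) i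
    rw [Measure.map_apply hπ isClosed_frontier.measurableSet] at this
    exact measure_eq_zero_iff_ae_notMem.1 this
  have hinv : ∀ ν : Measure (codeSpace U), InvProb (codeShift hσ) ν →
      (ν.map (codedPoint U)).map (itineraryCode U) = ν := fun ν hν => by
    rw [Measure.map_map hs hπ]
    conv_rhs => rw [← Measure.map_id (μ := ν)]
    exact Measure.map_congr ((hae ν hν).mono hsec)
  refine ⟨⟨hmap, fun ν₁ h₁ ν₂ h₂ h => ?_, fun μ hμ => ?_⟩, fun ν hν => ?_⟩
  · rw [← hinv ν₁ h₁, ← hinv ν₂ h₂]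
    exact congrArg _ h
  · refine ⟨μ.map (itineraryCode U),
      hμ.map hs (codeShift hσ).measurable (itineraryCode_apply hσ), ?_⟩
    rw [Measure.map_map hπ hs]
    convert Measure.map_id
    funext x
    exact codedPoint_eq hsep (codes_itinerary U x)
  · have := hν.1
    have hB : MeasurableSet {c | ∀ i, codedPoint U c ∉ frontier (U i)} := by
      rw [Set.ofPred_forall]
      exact .iInter fun i => (hπ isClosed_frontier.measurableSet).compl
    refine ⟨_, hB, (prob_compl_eq_zero_iff hB).1 (hae ν hν), fun c hc d hd h => ?_⟩
    rw [← hsec c hc, ← hsec d hd, h]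

theorem stmt_3 {X : Type*} [MetricSpace X] [CompactSpace X] [Nonempty X]
    [MeasurableSpace X] [BorelSpace X] (T : X ≃ₜ X)
    (hsbp : ∃ B : Set (Set X), IsTopologicalBasis B ∧ ∀ U ∈ B, IsOpen U ∧
      ∀ μ : Measure X, InvProb T μ → μ (frontier U) = 0) :
    ∃ (X' : Type) (_ : MetricSpace X') (_ : CompactSpace X') (_ : Nonempty X')
      (_ : MeasurableSpace X') (_ : BorelSpace X') (T' : X' ≃ₜ X') (π : X' → X),
      ZeroDim X' ∧
      Continuous π ∧ Function.Surjective π ∧ (∀ x : X', π (T' x) = T (π x)) ∧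
      Set.BijOn (Measure.map π) {ν : Measure X' | InvProb T' ν} {μ : Measure X | InvProb T μ} ∧
      ∀ ν : Measure X', InvProb T' ν →
        ∃ B : Set X', MeasurableSet B ∧ ν B = 1 ∧ Set.InjOn π B := by
  obtain ⟨B, hB, hBU⟩ := hsbp
  obtain ⟨S, hSB, hSc, hS⟩ := hB.exists_countable
  have hSne : S.Nonempty := by
    obtain ⟨s, hs, -⟩ := hS.exists_subset_of_mem_open
      (Set.mem_univ (Classical.arbitrary X)) isOpen_univ
    exact ⟨s, hs⟩
  obtain ⟨V, rfl⟩ := hSc.exists_eq_range hSne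
  have hV : ∀ n, V n ∈ B := fun n => hSB ⟨n, rfl⟩
  let U : ℕ × ℤ → Set X := fun p => (T ^ p.2 : X ≃ₜ X) ⁻¹' V p.1
  let σ : ℕ × ℤ ≃ ℕ × ℤ := (Equiv.refl ℕ).prodCongr (Equiv.addRight 1)
  have hσ : ∀ i, U (σ i) = T ⁻¹' U i := fun i => by
    simp only [U, σ, Equiv.prodCongr_apply, Prod.map_snd, Prod.map_fst, Equiv.coe_addRight,
      zpow_add_one, Equiv.refl_apply]
    rfl
  have hU : ∀ i, IsOpen (U i) := fun i =>
    (hBU _ (hV i.1)).1.preimage (T ^ i.2 : X ≃ₜ X).continuous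
  have hsep : ∀ x y, x ≠ y → ∃ i, x ∈ U i ∧ y ∉ closure (U i) := fun x y hxy => by
    obtain ⟨_, ⟨n, rfl⟩, hx, hy⟩ := hS.exists_closure_subset (isOpen_ne.mem_nhds hxy)
    have hn : U (n, 0) = V n := by simp [U, Set.preimage]
    exact ⟨(n, 0), hn ▸ hx, fun h => hy (hn ▸ h) rfl⟩
  have hnull : ∀ μ : Measure X, InvProb T μ → ∀ i, μ (frontier (U i)) = 0 := fun μ hμ i => by
    rw [← Homeomorph.preimage_frontier,
      hμ.measure_preimage_zpow i.2 isClosed_frontier.measurableSet]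
    exact (hBU _ (hV i.1)).2 μ hμ
  exact ⟨codeSpace U, metrizableSpaceMetric _,
    isCompact_iff_compactSpace.1 (isClosed_codeSpace hU).isCompact,
    ⟨itineraryCode U (Classical.arbitrary X)⟩, inferInstance, inferInstance, codeShift hσ,
    codedPoint U, zeroDim_of_isClosed (isClosed_codeSpace hU), continuous_codedPoint hU hsep,
    fun x => ⟨itineraryCode U x, codedPoint_eq hsep (codes_itinerary U x)⟩,
    fun c => codedPoint_eq hsep ((codes_codedPoint U c).shift hσ),
    codedPoint_isomorphic hσ hU hsep hnull⟩
end

section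
/- Let (X,T) be an aperiodic zero-dimensional topological dynamical system (X a nonempty compact metric space with a basis of clopen sets, T : X → X a homeomorphism with no periodic points). Then there exist a sequence of clopen sets (F_k)_{k≥1} with F_{k+1} ⊆ F_k for all k, and positive integers a_k ≤ b_k, such that: (1) a_k → ∞ and b_k/a_k → 1 as k → ∞; (2) for every x ∈ X and every k, the visit set V_k(x) = {n ∈ ℤ : Tⁿx ∈ F_k} is unbounded above and unbounded below, and whenever m < n are consecutive elements of V_k(x) then a_k ≤ n − m ≤ b_k. -/
open TopologicalSpace Filter

/-- Aperiodicity: no periodic points. -/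
def Aperiodic' {X : Type*} (T : X ≃ X) : Prop :=
  ∀ (x : X) (n : ℕ), 1 ≤ n → (T ^ n) x ≠ x

/-- For every point, the set of visit times to `F` is unbounded above and below, and
the gaps between consecutive visits lie in `[a, b]`. -/
def MarkerSet {X : Type*} (T : X ≃ X) (F : Set X) (a b : ℕ) : Prop :=
  ∀ x : X,
    (∀ N : ℤ, ∃ n : ℤ, N < n ∧ (T ^ n) x ∈ F) ∧
    (∀ N : ℤ, ∃ n : ℤ, n < N ∧ (T ^ n) x ∈ F) ∧
    (∀ m n : ℤ, m < n → (T ^ m) x ∈ F → (T ^ n) x ∈ F →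
      (∀ j : ℤ, m < j → j < n → (T ^ j) x ∉ F) →
      (a : ℤ) ≤ n - m ∧ n - m ≤ (b : ℤ))

/-- Distinct visits of an orbit to `F` are at least `a` apart. -/
def Spaced {X : Type*} (e : Equiv.Perm X) (F : Set X) (a : ℤ) : Prop :=
  ∀ x ∈ F, ∀ j : ℤ, 0 < j → j < a → (e ^ j) x ∉ F

/-- Every orbit visits `F` within any `b` consecutive times. -/
def Syndetic {X : Type*} (e : Equiv.Perm X) (F : Set X) (b : ℤ) : Prop :=
  ∀ x, ∃ j : ℤ, 1 ≤ j ∧ j ≤ b ∧ (e ^ j) x ∈ F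

section Visits

variable {X : Type*} {e : Equiv.Perm X} {F : Set X} {a b : ℤ}

lemma zpow_zpow_apply (m n : ℤ) (x : X) : (e ^ m) ((e ^ n) x) = (e ^ (m + n)) x := by
  rw [zpow_add, Equiv.Perm.mul_apply]

lemma Spaced.le_sub (h : Spaced e F a) {x : X} {m n : ℤ} (hmn : m < n)
    (hm : (e ^ m) x ∈ F) (hn : (e ^ n) x ∈ F) : a ≤ n - m := by
  by_contra! hlt
  refine h _ hm (n - m) (by lia) hlt ?_
  rwa [zpow_zpow_apply, sub_add_cancel]

lemma Syndetic.exists_mem (h : Syndetic e F b) (x : X) (n : ℤ) :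
    ∃ j : ℤ, n < j ∧ j ≤ n + b ∧ (e ^ j) x ∈ F := by
  obtain ⟨j, h1, h2, h3⟩ := h ((e ^ n) x)
  rw [zpow_zpow_apply] at h3
  exact ⟨j + n, by lia, by lia, h3⟩

/-- The first visit at or after time `n`. -/
lemma Syndetic.exists_first (h : Syndetic e F b) (x : X) (n : ℤ) :
    ∃ t : ℤ, n ≤ t ∧ t < n + b ∧ (e ^ t) x ∈ F ∧ ∀ i, n ≤ i → i < t → (e ^ i) x ∉ F := by
  obtain ⟨j, h1, h2, h3⟩ := h.exists_mem x (n - 1)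
  obtain ⟨t, ⟨ht1, ht2⟩, ht3⟩ := Int.exists_least_of_bdd
    (P := fun t => n ≤ t ∧ (e ^ t) x ∈ F) ⟨n, fun z hz => hz.1⟩ ⟨j, by lia, h3⟩
  refine ⟨t, ht1, ?_, ht2, fun i hi hit hiF => ?_⟩
  · have := ht3 j ⟨by lia, h3⟩
    lia
  · have := ht3 i ⟨hi, hiF⟩
    lia

/-- The last visit at or before time `n`. -/
lemma Syndetic.exists_last (h : Syndetic e F b) (x : X) (n : ℤ) :
    ∃ t : ℤ, t ≤ n ∧ (e ^ t) x ∈ F ∧ ∀ i, t < i → i ≤ n → (e ^ i) x ∉ F := by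
  obtain ⟨j, h1, h2, h3⟩ := h.exists_mem x (n - b)
  obtain ⟨t, ⟨ht1, ht2⟩, ht3⟩ := Int.exists_greatest_of_bdd
    (P := fun t => t ≤ n ∧ (e ^ t) x ∈ F) ⟨n, fun z hz => hz.1⟩ ⟨j, by lia, h3⟩
  refine ⟨t, ht1, ht2, fun i hi hit hiF => ?_⟩
  have := ht3 i ⟨hit, hiF⟩
  lia

lemma markerSet_of_spaced_of_syndetic {a b : ℕ} (ha : Spaced e F a) (hb : Syndetic e F b) :
    MarkerSet e F a b := by
  refine fun x => ⟨fun N => ?_, fun N => ?_, fun m n hmn hm hn hj => ⟨ha.le_sub hmn hm hn, ?_⟩⟩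
  · obtain ⟨j, h1, -, h3⟩ := hb.exists_mem x N
    exact ⟨j, h1, h3⟩
  · obtain ⟨j, h1, h2, h3⟩ := hb.exists_mem x (N - 1 - b)
    exact ⟨j, by lia, h3⟩
  · obtain ⟨j, h1, h2, h3⟩ := hb.exists_mem x m
    by_contra! hlt
    exact hj j h1 (by lia) h3

end Visits

section Construction

variable {X : Type*} [TopologicalSpace X] {e : Equiv.Perm X}

lemma isClopen_zpow_preimage (he : ∀ n : ℤ, Continuous (e ^ n)) {F : Set X} (hF : IsClopen F)
    (n : ℤ) : IsClopen {x | (e ^ n) x ∈ F} :=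
  hF.preimage (he n)

lemma exists_nhds_spaced [T2Space X] (he : ∀ n : ℤ, Continuous (e ^ n))
    (hfree : ∀ (x : X) (n : ℤ), 0 < n → (e ^ n) x ≠ x) (x : X) (n : ℤ) :
    ∃ U ∈ nhds x, Spaced e U n := by
  have key : ∀ᶠ U in (nhds x).smallSets, ∀ j ∈ Finset.Ioo 0 n, ∀ y ∈ U, (e ^ j) y ∉ U := by
    rw [Filter.eventually_all_finset]
    intro j hj
    obtain ⟨u, v, hu, hv, hxu, hxv, huv⟩ := t2_separation (hfree x j (Finset.mem_Ioo.1 hj).1).symm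
    rw [Filter.eventually_smallSets]
    refine ⟨u ∩ (e ^ j) ⁻¹' v,
      ((hu.inter (hv.preimage (he j))).mem_nhds ⟨hxu, hxv⟩), fun t ht y hy hy' => ?_⟩
    exact Set.disjoint_left.1 huv (ht hy').1 (ht hy).2
  obtain ⟨U, hU, h⟩ := Filter.eventually_smallSets.1 key
  exact ⟨U, hU, fun y hy j h0 hn => h U subset_rfl j (Finset.mem_Ioo.2 ⟨h0, hn⟩) y hy⟩

/-- Every aperiodic zero-dimensional system has clopen marker sets with arbitrarily large
gaps. -/
lemma exists_isClopen_spaced_syndetic [T2Space X] [CompactSpace X] (hzero : ZeroDim X)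
    (he : ∀ n : ℤ, Continuous (e ^ n))
    (hfree : ∀ (x : X) (n : ℤ), 0 < n → (e ^ n) x ≠ x) {n : ℤ} (hn : 0 < n) :
    ∃ G : Set X, IsClopen G ∧ Spaced e G n ∧ Syndetic e G (2 * n) := by
  have key : ∀ G : Set X, IsClopen G → Spaced e G n → ∃ G', G ⊆ G' ∧ IsClopen G' ∧
      Spaced e G' n ∧ ∀ x ∈ (Set.univ : Set X), ∃ j : ℤ, -n < j ∧ j < n ∧ (e ^ j) x ∈ G' := by
    refine isCompact_univ.induction_on
      (p := fun s => ∀ G : Set X, IsClopen G → Spaced e G n → ∃ G', G ⊆ G' ∧ IsClopen G' ∧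
        Spaced e G' n ∧ ∀ x ∈ s, ∃ j : ℤ, -n < j ∧ j < n ∧ (e ^ j) x ∈ G') ?_ ?_ ?_ ?_
    · exact fun G hG hs => ⟨G, subset_rfl, hG, hs, by simp⟩
    · intro s t hst ht G hG hs
      obtain ⟨G', h1, h2, h3, h4⟩ := ht G hG hs
      exact ⟨G', h1, h2, h3, fun x hx => h4 x (hst hx)⟩
    · intro s t hs ht G hG hGs
      obtain ⟨G', h1, h2, h3, h4⟩ := hs G hG hGs
      obtain ⟨G'', k1, k2, k3, k4⟩ := ht G' h2 h3
      refine ⟨G'', h1.trans k1, k2, k3, fun x hx => hx.elim (fun hx => ?_) (k4 x)⟩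
      obtain ⟨j, hj1, hj2, hj3⟩ := h4 x hx
      exact ⟨j, hj1, hj2, k1 hj3⟩
    · intro x _
      obtain ⟨V, hV, hVs⟩ := exists_nhds_spaced he hfree x n
      obtain ⟨B, hB, hBb⟩ := hzero
      obtain ⟨U, hUB, hxU, hUV⟩ := hBb.mem_nhds_iff.1 hV
      refine ⟨U, mem_nhdsWithin_of_mem_nhds ((hB U hUB).isOpen.mem_nhds hxU), ?_⟩
      intro G hG hGs
      refine ⟨G ∪ (U \ ⋃ j ∈ Finset.Ioo (-n) n, {x | (e ^ j) x ∈ G}), Set.subset_union_left,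
        hG.union ((hB U hUB).diff
          (isClopen_biUnion_finset fun j _ => isClopen_zpow_preimage he hG j)), ?_, ?_⟩
      · rintro y (hy | ⟨hy, hy'⟩) j h0 hjn (hz | ⟨hz, hz'⟩)
        · exact hGs y hy j h0 hjn hz
        · refine hz' (Set.mem_biUnion (x := -j) (by simp; lia) ?_)
          simpa [zpow_zpow_apply] using hy
        · exact hy' (Set.mem_biUnion (x := j) (by simp; lia) hz)
        · exact hVs y (hUV hy) j h0 hjn (hUV hz)
      · intro y hy
        by_cases hyG : y ∈ ⋃ j ∈ Finset.Ioo (-n) n, {x | (e ^ j) x ∈ G}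
        · simp only [Set.mem_iUnion, Finset.mem_Ioo] at hyG
          obtain ⟨j, ⟨hj1, hj2⟩, hj3⟩ := hyG
          exact ⟨j, hj1, hj2, Or.inl hj3⟩
        · exact ⟨0, by lia, hn, Or.inr (by simpa using ⟨hy, by simpa using hyG⟩)⟩
  obtain ⟨G, -, h2, h3, h4⟩ := key ∅ isClopen_empty (by simp [Spaced])
  refine ⟨G, h2, h3, fun x => ?_⟩
  obtain ⟨j, hj1, hj2, hj3⟩ := h4 ((e ^ n) x) trivial
  rw [zpow_zpow_apply] at hj3
  exact ⟨j + n, by lia, by lia, hj3⟩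

/-- Cutting each long gap `g = q * L + r` into `r` pieces of length `L + 1` followed by `q - r`
pieces of length `L`. -/
lemma exists_isClopen_spaced_syndetic_succ (he : ∀ n : ℤ, Continuous (e ^ n)) {L M : ℤ}
    (hL : 0 < L) {G : Set X} (hG : IsClopen G) (hGs : Spaced e G (L * L)) (hGM : Syndetic e G M) :
    ∃ H : Set X, IsClopen H ∧ Spaced e H L ∧ Syndetic e H (L + 1) := by
  set pos : ℤ → ℤ → ℤ := fun g i => i * L + min i (g % L) with hpos
  have pos_zero : ∀ g, pos g 0 = 0 := fun g => by
    have := Int.emod_nonneg g hL.ne'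
    simp [hpos, this]
  have pos_last : ∀ g, L * L ≤ g → pos g (g / L) = g := fun g hg => by
    have h1 : L ≤ g / L := (Int.le_ediv_iff_mul_le hL).2 hg
    have h2 := Int.emod_lt_of_pos g hL
    have h3 := Int.ediv_mul_add_emod g L
    simp only [hpos]
    rw [min_eq_right (by lia), h3]
  have pos_succ : ∀ g i, pos g i + L ≤ pos g (i + 1) ∧ pos g (i + 1) ≤ pos g i + (L + 1) :=
    fun g i => by
      simp only [hpos, add_mul]
      lia
  have pos_lt : ∀ g i j, i < j → pos g i + L ≤ pos g j := fun g i j hij => by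
    have : (i + 1) * L ≤ j * L := mul_le_mul_of_nonneg_right hij hL.le
    simp only [hpos]
    lia
  let gap : ℤ → Set X := fun g => G ∩ ({x | (e ^ g) x ∈ G} ∩
    ⋂ j ∈ Finset.Ioo 0 g, {x | (e ^ j) x ∈ G}ᶜ)
  have gap_clopen : ∀ g, IsClopen (gap g) := fun g =>
    hG.inter ((isClopen_zpow_preimage he hG g).inter
      (isClopen_biInter_finset fun j _ => (isClopen_zpow_preimage he hG j).compl))
  let H : Set X := ⋃ g ∈ Finset.Icc (L * L) M, ⋃ i ∈ Finset.Ico 0 (g / L),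
    {x | (e ^ (-pos g i)) x ∈ gap g}
  have mem_H : ∀ (x : X) (n : ℤ), (e ^ n) x ∈ H ↔ ∃ s g i : ℤ, L * L ≤ g ∧ g ≤ M ∧ 0 ≤ i ∧
      i < g / L ∧ n = s + pos g i ∧ (e ^ s) x ∈ G ∧ (e ^ (s + g)) x ∈ G ∧
      ∀ t, s < t → t < s + g → (e ^ t) x ∉ G := by
    intro x n
    simp only [H, gap, Set.mem_iUnion, Finset.mem_Icc, Finset.mem_Ico, exists_prop,
      Set.mem_ofPred_eq, Set.mem_inter_iff, Set.mem_iInter, Finset.mem_Ioo, Set.mem_compl_iff,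
      zpow_zpow_apply]
    constructor
    · rintro ⟨g, ⟨h1, h2⟩, i, ⟨h3, h4⟩, h5, h6, h7⟩
      refine ⟨-pos g i + n, g, i, h1, h2, h3, h4, by lia, h5, ?_, ?_⟩
      · rwa [show -pos g i + n + g = g + -pos g i + n by ring]
      · intro t ht1 ht2
        have := h7 (t - (-pos g i + n)) ⟨by lia, by lia⟩
        rwa [show t - (-pos g i + n) + -pos g i + n = t by ring] at this
    · rintro ⟨s, g, i, h1, h2, h3, h4, rfl, h5, h6, h7⟩
      refine ⟨g, ⟨h1, h2⟩, i, ⟨h3, h4⟩, ?_, ?_, fun j hj => h7 _ (by lia) (by lia)⟩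
      · rwa [show -pos g i + (s + pos g i) = s by ring]
      · rwa [show g + -pos g i + (s + pos g i) = s + g by ring]
  have exists_gap : ∀ (x : X) (n : ℤ), ∃ s g : ℤ, s ≤ n ∧ n < s + g ∧ L * L ≤ g ∧ g ≤ M ∧
      (e ^ s) x ∈ G ∧ (e ^ (s + g)) x ∈ G ∧ ∀ t, s < t → t < s + g → (e ^ t) x ∉ G := by
    intro x n
    obtain ⟨s, hs1, hs2, hs3⟩ := hGM.exists_last x n
    obtain ⟨t, ht1, ht2, ht3, ht4⟩ := hGM.exists_first x (s + 1)
    have htn : n < t := by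
      by_contra! h
      exact hs3 t (by lia) h ht3
    refine ⟨s, t - s, hs1, by lia, hGs.le_sub (by lia) hs2 ht3, by lia, hs2, ?_, ?_⟩
    · rwa [add_sub_cancel]
    · exact fun i hi1 hi2 => ht4 i (by lia) (by lia)
  have G_sub : ∀ (x : X) (n : ℤ), (e ^ n) x ∈ G → (e ^ n) x ∈ H := by
    intro x n hn
    obtain ⟨s, g, h1, h2, h3, h4, h5, h6, h7⟩ := exists_gap x n
    have hsn : s = n := by
      by_contra hne
      exact h7 n (by lia) h2 hn
    subst hsn
    refine (mem_H x s).2 ⟨s, g, 0, h3, h4, le_rfl, ?_, by simp [pos_zero], h5, h6, h7⟩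
    have : L ≤ g / L := (Int.le_ediv_iff_mul_le hL).2 h3
    lia
  refine ⟨H, isClopen_biUnion_finset fun g _ => isClopen_biUnion_finset fun i _ =>
    isClopen_zpow_preimage he (gap_clopen g) _, ?_, ?_⟩
  · intro x hx j hj0 hjL hj
    obtain ⟨s, g, i, h1, h2, h3, h4, h5, h6, h7, h8⟩ := (mem_H x 0).1 (by simpa using hx)
    obtain ⟨s', g', i', k1, k2, k3, k4, k5, k6, k7, k8⟩ := (mem_H x j).1 hj
    have p1 := pos_lt g i _ h4
    have p2 := pos_lt g' i' _ k4
    rw [pos_last g h1] at p1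
    rw [pos_last g' k1] at p2
    have p3 : 0 ≤ pos g i := by
      rcases h3.eq_or_lt with rfl | h
      · rw [pos_zero]
      · have := pos_lt g 0 i h
        rw [pos_zero] at this
        lia
    have p4 : 0 ≤ pos g' i' := by
      rcases k3.eq_or_lt with rfl | h
      · rw [pos_zero]
      · have := pos_lt g' 0 i' h
        rw [pos_zero] at this
        lia
    rcases lt_trichotomy s s' with hlt | rfl | hlt
    · have : s + g ≤ s' := by
        by_contra! h
        exact h8 s' hlt h k6
      lia
    · have hgg : g = g' := by
        rcases lt_trichotomy g g' with h | h | h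
        · exact absurd h7 (k8 _ (by lia) (by lia))
        · exact h
        · exact absurd k7 (h8 _ (by lia) (by lia))
      subst hgg
      rcases lt_trichotomy i i' with h | rfl | h
      · have := pos_lt g i i' h
        lia
      · lia
      · have := pos_lt g i' i h
        lia
    · have : s' + g' ≤ s := by
        by_contra! h
        exact k8 s hlt h h6
      lia
  · intro x
    obtain ⟨s, g, h1, h2, h3, h4, h5, h6, h7⟩ := exists_gap x 0
    have hq : 0 < g / L := hL.trans_le ((Int.le_ediv_iff_mul_le hL).2 h3)
    obtain ⟨i, ⟨hi1, hi2⟩, hi3⟩ := Int.exists_least_of_bdd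
      (P := fun i => 0 ≤ i ∧ 0 < s + pos g i) ⟨0, fun z hz => hz.1⟩
      ⟨g / L, hq.le, by rwa [pos_last g h3]⟩
    have hi0 : 0 < i := by
      refine hi1.lt_of_ne ?_
      rintro rfl
      rw [pos_zero] at hi2
      lia
    have hprev : s + pos g (i - 1) ≤ 0 := by
      by_contra! h
      have := hi3 (i - 1) ⟨by lia, h⟩
      lia
    have hstep := (pos_succ g (i - 1)).2
    rw [sub_add_cancel] at hstep
    refine ⟨s + pos g i, hi2, by lia, ?_⟩
    have hiq : i ≤ g / L := hi3 _ ⟨hq.le, by rwa [pos_last g h3]⟩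
    rcases hiq.eq_or_lt with rfl | hlt
    · rw [pos_last g h3]
      exact G_sub x _ h6
    · exact (mem_H x _).2 ⟨s, g, i, h3, h4, hi1, hlt, rfl, h5, h6, h7⟩

/-- Replacing each visit to `H` by the first visit to `F` at or after it. -/
lemma exists_isClopen_subset_spaced_syndetic (he : ∀ n : ℤ, Continuous (e ^ n)) {F H : Set X}
    {a b c : ℤ} (hF : IsClopen F) (hFb : Syndetic e F b) (hH : IsClopen H)
    (hHa : Spaced e H a) (hHc : Syndetic e H c) :
    ∃ F' ⊆ F, IsClopen F' ∧ Spaced e F' (a - b) ∧ Syndetic e F' (c + b) := by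
  let F' : Set X := F ∩ ⋃ j ∈ Finset.Ico 0 b, ({x | (e ^ (-j)) x ∈ H} ∩
    ⋂ i ∈ Finset.Icc 1 j, {x | (e ^ (-i)) x ∈ F}ᶜ)
  have mem_F' : ∀ (x : X) (n : ℤ), (e ^ n) x ∈ F' ↔ (e ^ n) x ∈ F ∧ ∃ h : ℤ, h ≤ n ∧ n < h + b ∧
      (e ^ h) x ∈ H ∧ ∀ i, h ≤ i → i < n → (e ^ i) x ∉ F := by
    intro x n
    simp only [F', Set.mem_iUnion, Finset.mem_Icc, Finset.mem_Ico, exists_prop,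
      Set.mem_ofPred_eq, Set.mem_inter_iff, Set.mem_iInter, Set.mem_compl_iff, zpow_zpow_apply]
    refine and_congr_right fun _ => ⟨?_, ?_⟩
    · rintro ⟨j, ⟨h1, h2⟩, h3, h4⟩
      refine ⟨-j + n, by lia, by lia, h3, fun i hi1 hi2 => ?_⟩
      have := h4 (n - i) ⟨by lia, by lia⟩
      rwa [show -(n - i) + n = i by ring] at this
    · rintro ⟨h, h1, h2, h3, h4⟩
      refine ⟨n - h, ⟨by lia, by lia⟩, ?_, fun i hi => h4 _ (by lia) (by lia)⟩
      rwa [show -(n - h) + n = h by ring]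
  refine ⟨F', Set.inter_subset_left, hF.inter (isClopen_biUnion_finset fun j _ =>
    (isClopen_zpow_preimage he hH _).inter (isClopen_biInter_finset fun i _ =>
      (isClopen_zpow_preimage he hF _).compl)), ?_, ?_⟩
  · intro x hx j hj0 hja hj
    obtain ⟨hxF, h, h1, h2, h3, h4⟩ := (mem_F' x 0).1 (by simpa using hx)
    obtain ⟨hjF, k, k1, k2, k3, k4⟩ := (mem_F' x j).1 hj
    have hk : 0 < k := by
      by_contra! hk
      exact k4 0 hk hj0 hxF
    have := hHa.le_sub (h1.trans_lt hk) h3 k3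
    lia
  · intro x
    obtain ⟨h, h1, h2, h3⟩ := hHc x
    obtain ⟨t, t1, t2, t3, t4⟩ := hFb.exists_first x h
    exact ⟨t, by lia, by lia, (mem_F' x t).2 ⟨t3, h, t1, t2, h3, t4⟩⟩

/-- A syndetic clopen set contains a clopen marker set whose gaps are long compared to their
variation. -/
lemma exists_isClopen_subset_balanced [T2Space X] [CompactSpace X] (hzero : ZeroDim X)
    (he : ∀ n : ℤ, Continuous (e ^ n)) (hfree : ∀ (x : X) (n : ℤ), 0 < n → (e ^ n) x ≠ x)
    {F : Set X} {b : ℕ} (hF : IsClopen F) (hFb : Syndetic e F b) (a : ℕ) (ha : 0 < a) :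
    ∃ F' ⊆ F, IsClopen F' ∧ Spaced e F' a ∧ Syndetic e F' ((a + (2 * b + 1) : ℕ) : ℤ) := by
  have hL : (0 : ℤ) < a + b := by lia
  obtain ⟨G, hG, hGs, hGM⟩ := exists_isClopen_spaced_syndetic hzero he hfree (mul_pos hL hL)
  obtain ⟨H, hH, hHs, hHM⟩ := exists_isClopen_spaced_syndetic_succ he hL hG hGs hGM
  obtain ⟨F', h1, h2, h3, h4⟩ := exists_isClopen_subset_spaced_syndetic he hF hFb hH hHs hHM
  refine ⟨F', h1, h2, ?_, ?_⟩
  · rwa [add_sub_cancel_right] at h3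
  · convert h4 using 1
    push_cast
    ring

end Construction

theorem stmt_6 {X : Type*} [MetricSpace X] [CompactSpace X] [Nonempty X] (T : X ≃ₜ X)
    (hzero : ZeroDim X) (haper : Aperiodic' T.toEquiv) :
    ∃ (F : ℕ → Set X) (a b : ℕ → ℕ),
      (∀ k, IsClopen (F k)) ∧ (∀ k, F (k + 1) ⊆ F k) ∧
      (∀ k, 0 < a k) ∧ (∀ k, a k ≤ b k) ∧
      Tendsto a atTop atTop ∧
      Tendsto (fun k => (b k : ℝ) / (a k : ℝ)) atTop (nhds 1) ∧
      ∀ k, MarkerSet T.toEquiv (F k) (a k) (b k) := by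
  set e : Equiv.Perm X := T.toEquiv
  have hnat : ∀ n : ℕ, Continuous (e ^ n) := fun n => by
    rw [Equiv.Perm.coe_pow]
    exact T.continuous.iterate n
  have hinv : ∀ n : ℕ, Continuous (e⁻¹ ^ n) := fun n => by
    rw [Equiv.Perm.coe_pow]
    exact T.symm.continuous.iterate n
  have he : ∀ n : ℤ, Continuous (e ^ n) := by
    intro n
    obtain ⟨m, rfl | rfl⟩ := n.eq_nat_or_neg
    · simpa only [zpow_natCast] using hnat m
    · simpa only [zpow_neg, zpow_natCast, inv_pow] using hinv m
  have hfree : ∀ (x : X) (n : ℤ), 0 < n → (e ^ n) x ≠ x := by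
    intro x n hn
    lift n to ℕ using hn.le
    simpa only [zpow_natCast] using haper x n (by lia)
  choose f hf using fun (k : ℕ) (p : {p : Set X × ℕ // IsClopen p.1 ∧ Syndetic e p.1 p.2}) =>
    exists_isClopen_subset_balanced hzero he hfree p.2.1 p.2.2
      ((k + 1) * (2 * p.1.2 + 1)) (by positivity)
  let seq : ℕ → {p : Set X × ℕ // IsClopen p.1 ∧ Syndetic e p.1 p.2} := fun n =>
    Nat.rec ⟨(Set.univ, 1), isClopen_univ, fun x => ⟨1, le_rfl, by simp, trivial⟩⟩
      (fun k p => ⟨(f k p, _), (hf k p).2.1, (hf k p).2.2.2⟩) n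
  refine ⟨fun k => (seq (k + 1)).1.1, fun k => (k + 1) * (2 * (seq k).1.2 + 1),
    fun k => (seq (k + 1)).1.2, fun k => (seq (k + 1)).2.1, fun k => (hf (k + 1) (seq (k + 1))).1,
    fun k => by positivity, fun k => Nat.le_add_right _ _, ?_, ?_, fun k => ?_⟩
  · refine tendsto_atTop_mono (fun k => ?_) tendsto_id
    simp only [id]
    nlinarith
  · have h : Tendsto (fun k : ℕ => 1 + 1 / ((k : ℝ) + 1)) atTop (nhds (1 + 0)) :=
      tendsto_const_nhds.add tendsto_one_div_add_atTop_nhds_zero_nat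
    rw [add_zero] at h
    refine h.congr fun k => ?_
    have hb : (seq (k + 1)).1.2 = (k + 1) * (2 * (seq k).1.2 + 1) + (2 * (seq k).1.2 + 1) := rfl
    simp only [hb]
    push_cast
    field_simp
  · exact markerSet_of_spaced_of_syndetic (hf k (seq k)).2.2.1 (seq (k + 1)).2.2
end

section
/- Let (X,T) be an aperiodic zero-dimensional topological dynamical system (X a nonempty compact metric space with a basis of clopen sets, T : X → X a homeomorphism with no periodic points), and let (Q_k)_{k≥1} be a refining sequence of finite clopen partitions of X (each Q_{k+1} refines Q_k, and the maximal diameter of atoms of Q_k tends to 0). For a clopen set F ⊆ X all of whose points have positive return times to F, define the set of k-rectangles R_k(F) as the set of pairs (ℓ, w) with ℓ ≥ 1 and w : {0,…,ℓ−1} → Q_k, such that there exists x ∈ F whose first return time min{n ≥ 1 : Tⁿx ∈ F} equals ℓ and T^i x ∈ w(i) for all 0 ≤ i < ℓ. Then there exists a function N : ℕ → ℕ with the following property: for every nested balanced system of marker sets—clopen sets F_{k+1} ⊆ F_k and positive integers a_k ≤ b_k with a_k → ∞, b_k/a_k → 1, and a_k ≥ N(k) for all k, such that for every x ∈ X and k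 the visit set {n ∈ ℤ : Tⁿx ∈ F_k} is unbounded in both directions with consecutive gaps in [a_k, b_k]—the topological entropy of (X,T) equals lim_{k→∞} (1/a_k) · log₂ #R_k(F_k). -/
open TopologicalSpace Filter Dynamics

/-- `Q` is a refining sequence of finite clopen partitions with diameters tending to zero. -/
def RefiningClopenPartitions {X : Type*} [MetricSpace X] (Q : ℕ → Finset (Set X)) : Prop :=
  (∀ k, ∀ s ∈ Q k, IsClopen s) ∧
  (∀ k, ∀ s ∈ Q k, ∀ t ∈ Q k, s ≠ t → Disjoint s t) ∧
  (∀ k, ⋃ s ∈ (Q k : Set (Set X)), s = Set.univ) ∧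
  (∀ k, ∀ s ∈ Q (k + 1), ∃ t ∈ Q k, s ⊆ t) ∧
  (∀ ε > (0 : ℝ), ∃ K : ℕ, ∀ k ≥ K, ∀ s ∈ Q k, Metric.diam s ≤ ε)

/-- The set of `k`-rectangles over the partition `Q` determined by the return times to `F`:
pairs `(ℓ, w)` where `ℓ ≥ 1` is the first return time to `F` of some `x ∈ F` and `w` records
the atoms of `Q` visited by `x, Tx, …, T^{ℓ-1}x`. -/
def kRectangles {X : Type*} (T : X ≃ X) (Q : Finset (Set X)) (F : Set X) :
    Set (Σ ℓ : ℕ, Fin ℓ → Set X) :=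
  {p | 1 ≤ p.1 ∧ (∀ i : Fin p.1, p.2 i ∈ Q) ∧
    ∃ x ∈ F, (T ^ (p.1 : ℤ)) x ∈ F ∧
      (∀ j : ℤ, 1 ≤ j → j < (p.1 : ℤ) → (T ^ j) x ∉ F) ∧
      ∀ i : Fin p.1, (T ^ (i : ℤ)) x ∈ p.2 i}

/-- The relation of having the same image under `A`. -/
def sameValue {X α : Type*} (A : X → α) : SetRel X X := {p | A p.1 = A p.2}

lemma mem_sameValue {X α : Type*} {A : X → α} {x y : X} :
    (x, y) ∈ sameValue A ↔ A x = A y := Iff.rfl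

instance {X α : Type*} (A : X → α) : (sameValue A).IsSymm := ⟨fun _ _ h => Eq.symm h⟩

instance {X α : Type*} (A : X → α) : (sameValue A).IsRefl := ⟨fun _ => rfl⟩

instance {X α : Type*} (A : X → α) : (sameValue A).IsTrans := ⟨fun _ _ _ h h' => Eq.trans h h'⟩

/-- A finite-valued code on `X` whose fibres have constant `A`-itineraries up to time `n`
bounds the size of minimal dynamical covers. -/
lemma coverMincard_le_card_of_code {X α ι : Type*} [Fintype ι] (T : X → X) (A : X → α) (n : ℕ)
    (f : X → ι) (hf : ∀ x y, f x = f y → ∀ j < n, A (T^[j] x) = A (T^[j] y)) :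
    coverMincard T Set.univ (sameValue A) n ≤ Fintype.card ι := by
  classical
  have hg : ∀ i : Set.range f, ∃ x, f x = i := fun i => i.2
  choose g hg using hg
  have hcov : IsDynCoverOf T Set.univ (sameValue A) n
      ((Finset.univ.image g : Finset X) : Set X) := by
    intro x _
    refine ⟨g ⟨f x, x, rfl⟩, by simp, ?_⟩
    exact mem_dynEntourage.2 fun j hj => hf _ _ (hg ⟨f x, x, rfl⟩).symm j hj
  refine hcov.coverMincard_le_card.trans ?_
  have h1 := (Finset.card_image_le (s := Finset.univ) (f := g))
  have h2 : Fintype.card (Set.range f) ≤ Fintype.card ι :=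
    Fintype.card_le_of_injective _ Subtype.val_injective
  exact_mod_cast h1.trans h2

section Rectangles

variable {X : Type*} {T : X ≃ X} {Q : Finset (Set X)} {F : Set X} {a b : ℕ}

lemma MarkerSet.exists_next (hF : MarkerSet T F a b) (x : X) :
    ∃ n : ℕ, 1 ≤ n ∧ (T ^ (n : ℤ)) x ∈ F ∧
      ∀ j : ℤ, 1 ≤ j → j < (n : ℤ) → (T ^ j) x ∉ F := by
  classical
  have hex : ∃ n : ℕ, 1 ≤ n ∧ (T ^ (n : ℤ)) x ∈ F := by
    obtain ⟨n, hn, hx⟩ := (hF x).1 0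
    lift n to ℕ using hn.le
    exact ⟨n, by exact_mod_cast hn, hx⟩
  refine ⟨Nat.find hex, (Nat.find_spec hex).1, (Nat.find_spec hex).2, fun j hj hjn hx => ?_⟩
  lift j to ℕ using by omega
  exact Nat.find_min hex (m := j) (by exact_mod_cast hjn) ⟨by exact_mod_cast hj, hx⟩

lemma MarkerSet.exists_prev (hF : MarkerSet T F a b) (x : X) :
    ∃ n : ℕ, n < b + 1 ∧ (T ^ (-(n : ℤ))) x ∈ F := by
  classical
  have hex : ∃ n : ℕ, (T ^ (-(n : ℤ))) x ∈ F := by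
    obtain ⟨n, hn, hx⟩ := (hF x).2.1 0
    obtain ⟨m, rfl⟩ : ∃ m : ℕ, n = -(m : ℤ) := ⟨(-n).toNat, by omega⟩
    exact ⟨m, hx⟩
  refine ⟨Nat.find hex, ?_, Nat.find_spec hex⟩
  obtain ⟨n, hn, hnF, hmin⟩ := hF.exists_next x
  have := (hF x).2.2 (-(Nat.find hex : ℤ)) n (by omega) (Nat.find_spec hex) hnF (by
    intro j hj hjn hjF
    rcases le_or_gt 1 j with h | h
    · exact hmin j h hjn hjF
    · obtain ⟨m, rfl⟩ : ∃ m : ℕ, j = -(m : ℤ) := ⟨(-j).toNat, by omega⟩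
      exact Nat.find_min hex (m := m) (by omega) hjF)
  omega

lemma MarkerSet.return_mem_Icc (hF : MarkerSet T F a b) {x : X} {n : ℕ} (hn : 1 ≤ n)
    (hx : x ∈ F) (hnF : (T ^ (n : ℤ)) x ∈ F)
    (hmin : ∀ j : ℤ, 1 ≤ j → j < (n : ℤ) → (T ^ j) x ∉ F) : a ≤ n ∧ n ≤ b := by
  have := (hF x).2.2 0 n (by omega) (by simpa using hx) hnF
    (fun j hj hjn => hmin j (by omega) hjn)
  omega

variable {A : X → Set X}

/-- The number of rectangles is at most the number of possible heights times the size of a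
dynamical cover. -/
lemma kRectangles_finite_card_le (hF : MarkerSet T F a b)
    (hAu : ∀ s ∈ Q, ∀ y ∈ s, s = A y) {s : Finset X}
    (hs : IsDynCoverOf T Set.univ (sameValue A) b s) :
    (kRectangles T Q F).Finite ∧ Nat.card (kRectangles T Q F) ≤ (b + 1) * s.card := by
  have key : ∀ p : kRectangles T Q F, ∃ q : Fin (b + 1) × s,
      p.1.1 = q.1 ∧ ∀ i : Fin p.1.1, p.1.2 i = A (T^[i] q.2) := by
    rintro ⟨⟨ℓ, w⟩, h1, hw, x, hx, hxF, hmin, hxw⟩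
    have hb := (hF.return_mem_Icc h1 hx hxF hmin).2
    dsimp only at h1 hw hxF hmin hxw hb
    obtain ⟨y, hy, hxy⟩ := hs (Set.mem_univ x)
    refine ⟨(⟨ℓ, by omega⟩, ⟨y, hy⟩), rfl, fun i => ?_⟩
    have := mem_dynEntourage.1 hxy i (i.2.trans_le hb)
    rw [mem_sameValue] at this
    rw [← this]
    exact hAu _ (hw i) _ (hxw i)
  choose f hf hf' using key
  have hinj : Function.Injective f := by
    rintro ⟨⟨ℓ, w⟩, hp⟩ ⟨⟨ℓ', w'⟩, hp'⟩ h
    have e1 := hf ⟨⟨ℓ, w⟩, hp⟩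
    have e1' := hf ⟨⟨ℓ', w'⟩, hp'⟩
    have e2 := hf' ⟨⟨ℓ, w⟩, hp⟩
    have e2' := hf' ⟨⟨ℓ', w'⟩, hp'⟩
    rw [← h] at e1' e2'
    obtain rfl : ℓ = ℓ' := e1.trans e1'.symm
    obtain rfl : w = w' := funext fun i => (e2 i).trans (e2' i).symm
    rfl
  refine ⟨Set.finite_coe_iff.1 (Finite.of_injective f hinj), ?_⟩
  have := Nat.card_le_card_of_injective f hinj
  simpa using this

/-- Each point of `F` has a rectangle recording its itinerary up to its first return. -/
lemma exists_rectangle (hF : MarkerSet T F a b) (hA : ∀ x, A x ∈ Q ∧ x ∈ A x) {x : X}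
    (hx : x ∈ F) : ∃ p : kRectangles T Q F, a ≤ p.1.1 ∧ (T ^ (p.1.1 : ℤ)) x ∈ F ∧
      ∀ i : Fin p.1.1, A ((T ^ (i : ℤ)) x) = p.1.2 i := by
  obtain ⟨n, hn, hnF, hmin⟩ := hF.exists_next x
  exact ⟨⟨⟨n, fun i => A ((T ^ (i : ℤ)) x)⟩, hn, fun i => (hA _).1, x, hx, hnF, hmin,
    fun i => (hA _).2⟩, (hF.return_mem_Icc hn hx hnF hmin).1, hnF, fun i => rfl⟩

/-- A sequence of `m` rectangles determines the itinerary of a point of `F` up to time `m * a`. -/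
lemma exists_rectangle_code (hF : MarkerSet T F a b) (hA : ∀ x, A x ∈ Q ∧ x ∈ A x) (m : ℕ) :
    ∃ g : F → (Fin m → kRectangles T Q F), ∀ x y : F, g x = g y →
      ∀ j : ℕ, j < m * a → A ((T ^ (j : ℤ)) x) = A ((T ^ (j : ℤ)) y) := by
  choose r hra hrF hrA using fun x : F => exists_rectangle hF hA x.2
  induction m with
  | zero => exact ⟨fun _ => Fin.elim0, by simp⟩
  | succ m ih =>
    obtain ⟨g, hg⟩ := ih
    refine ⟨fun x => Fin.cons (r x) (g ⟨_, hrF x⟩), fun x y hxy j hj => ?_⟩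
    obtain ⟨h1, h2⟩ := Fin.cons_inj.1 hxy
    rcases lt_or_ge j (r x).1.1 with hjr | hjr
    · have e1 := hrA x ⟨j, hjr⟩
      have e2 : ∀ h : j < (r y).1.1, A ((T ^ (j : ℤ)) y) = (r y).1.2 ⟨j, h⟩ :=
        fun h => hrA y ⟨j, h⟩
      rw [← h1] at e2
      exact e1.trans (e2 hjr).symm
    · have ha := hra x
      have := hg _ _ h2 (j - (r x).1.1) (by rw [Nat.succ_mul] at hj; omega)
      dsimp only at this
      rw [← h1, ← Equiv.Perm.mul_apply, ← Equiv.Perm.mul_apply, ← zpow_add,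
        Nat.cast_sub hjr, sub_add_cancel] at this
      exact this

/-- Itineraries of length `m * a` are determined by an offset and `m + b` rectangles. -/
lemma coverMincard_le_rectangles (hF : MarkerSet T F a b) (ha : 0 < a)
    (hA : ∀ x, A x ∈ Q ∧ x ∈ A x) (hfin : (kRectangles T Q F).Finite) (m : ℕ) :
    coverMincard T Set.univ (sameValue A) (m * a) ≤
      (((b + 1) * Nat.card (kRectangles T Q F) ^ (m + b) : ℕ) : ℕ∞) := by
  have := hfin.fintype
  obtain ⟨g, hg⟩ := exists_rectangle_code hF hA (m + b)
  choose d hd hdF using hF.exists_prev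
  have := coverMincard_le_card_of_code T A (m * a)
    (f := fun x => ((⟨d x, hd x⟩, g ⟨_, hdF x⟩) : Fin (b + 1) × _)) (by
      intro x y hxy j hj
      obtain ⟨h1, h2⟩ := Prod.mk.inj hxy
      have h1 : d x = d y := by simpa using h1
      have := hg _ _ h2 (j + d x) (by
        have := Nat.le_mul_of_pos_right b ha
        have := hd x
        rw [add_mul]; omega)
      dsimp only at this
      rw [← h1, ← Equiv.Perm.mul_apply, ← Equiv.Perm.mul_apply, ← zpow_add,
        Nat.cast_add, add_neg_cancel_right] at this
      exact this)
  simpa [Nat.card_eq_fintype_card] using this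

lemma card_kRectangles_pos [Nonempty X] (hF : MarkerSet T F a b)
    (hA : ∀ x, A x ∈ Q ∧ x ∈ A x) (hfin : (kRectangles T Q F).Finite) :
    0 < Nat.card (kRectangles T Q F) := by
  obtain ⟨x⟩ := ‹Nonempty X›
  obtain ⟨n, -, hx⟩ := hF.exists_prev x
  obtain ⟨p, -⟩ := exists_rectangle hF hA hx
  have := hfin.to_subtype
  have : Nonempty (kRectangles T Q F) := ⟨p⟩
  exact Nat.card_pos

lemma log_natCast_toENNReal {n : ℕ} (hn : 0 < n) :
    ENNReal.log (n : ENNReal) = (Real.log n : ℝ) := by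
  rw [ENNReal.log_pos_real' (by simpa using hn)]
  simp

/-- The entropy of a partition is at most the exponential rate of the number of rectangles. -/
lemma coverEntropyEntourage_le_log_rectangles [Nonempty X] (hF : MarkerSet T F a b) (ha : 0 < a)
    (hA : ∀ x, A x ∈ Q ∧ x ∈ A x) (hfin : (kRectangles T Q F).Finite) :
    coverEntropyEntourage T Set.univ (sameValue A) ≤
      ((Real.log (Nat.card (kRectangles T Q F)) / a : ℝ) : EReal) := by
  set R := Nat.card (kRectangles T Q F) with hR
  have hRpos : 0 < R := card_kRectangles_pos hF hA hfin
  have bound : ∀ m : ℕ, coverEntropyEntourage T Set.univ (sameValue A) ≤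
      (((Real.log (b + 1) + b * Real.log R) / a * (1 / ((m : ℝ) + 1)) + Real.log R / a : ℝ)
        : EReal) := by
    intro m
    have h := coverEntropyEntourage_le_log_coverMincard_div (T := T) (F := Set.univ)
      (U := sameValue A) (Set.mapsTo_univ _ _) (n := (m + 1) * a) (by positivity)
    rw [SetRel.comp_eq_self] at h
    refine h.trans ?_
    have h2 := coverMincard_le_rectangles hF ha hA hfin (m + 1)
    have h3 : ENNReal.log (coverMincard T Set.univ (sameValue A) ((m + 1) * a)) ≤
        ((Real.log (((b + 1) * R ^ (m + 1 + b) : ℕ) : ℝ) : ℝ) : EReal) := by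
      rw [← log_natCast_toENNReal (by positivity)]
      apply ENNReal.log_monotone
      exact_mod_cast ENat.toENNReal_mono h2
    refine (EReal.monotone_div_right_of_nonneg (Nat.cast_nonneg' _) h3).trans ?_
    have e : ((((m + 1) * a : ℕ) : ℕ) : EReal) = (((((m + 1) * a : ℕ) : ℕ) : ℝ) : EReal) := by
      norm_cast
    beta_reduce
    rw [e, ← EReal.coe_div, EReal.coe_le_coe_iff]
    push_cast
    rw [Real.log_mul (by positivity) (by positivity), Real.log_pow]
    apply le_of_eq
    push_cast
    field_simp
    ring
  have hlim : Tendsto (fun m : ℕ =>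
      (((Real.log (b + 1) + b * Real.log R) / a * (1 / ((m : ℝ) + 1)) + Real.log R / a : ℝ)
        : EReal)) atTop (nhds ((Real.log R / a : ℝ) : EReal)) := by
    rw [EReal.tendsto_coe]
    simpa using (tendsto_one_div_add_atTop_nhds_zero_nat.const_mul
      ((Real.log (b + 1) + b * Real.log R) / a)).add_const (Real.log R / a)
  exact ge_of_tendsto' hlim bound

end Rectangles

section Partitions

variable {X : Type*} [MetricSpace X] {Q : ℕ → Finset (Set X)}

lemma RefiningClopenPartitions.exists_atom (hQ : RefiningClopenPartitions Q) (k : ℕ) (x : X) :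
    ∃ s, s ∈ Q k ∧ x ∈ s := by
  have : x ∈ ⋃ s ∈ (Q k : Set (Set X)), s := hQ.2.2.1 k ▸ Set.mem_univ x
  simpa using this

lemma RefiningClopenPartitions.eq_of_mem (hQ : RefiningClopenPartitions Q) {k : ℕ} {s t : Set X}
    (hs : s ∈ Q k) (ht : t ∈ Q k) {x : X} (hxs : x ∈ s) (hxt : x ∈ t) : s = t := by
  by_contra h
  exact Set.disjoint_left.1 (hQ.2.1 k s hs t ht h) hxs hxt

variable {A : ℕ → X → Set X}

lemma RefiningClopenPartitions.sameValue_antitone (hQ : RefiningClopenPartitions Q)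
    (hA : ∀ k x, A k x ∈ Q k ∧ x ∈ A k x) : Antitone fun k => sameValue (A k) := by
  refine antitone_nat_of_succ_le fun k => ?_
  rintro ⟨x, y⟩ (h : A (k + 1) x = A (k + 1) y)
  obtain ⟨t, ht, hst⟩ := hQ.2.2.2.1 k _ (hA (k + 1) x).1
  have hx := hQ.eq_of_mem (hA k x).1 ht (hA k x).2 (hst (hA (k + 1) x).2)
  have hy := hQ.eq_of_mem (hA k y).1 ht (hA k y).2 (hst (h ▸ (hA (k + 1) y).2))
  exact hx.trans hy.symm

lemma RefiningClopenPartitions.sameValue_mem_uniformity [CompactSpace X]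
    (hQ : RefiningClopenPartitions Q) (hA : ∀ k x, A k x ∈ Q k ∧ x ∈ A k x) (k : ℕ) :
    sameValue (A k) ∈ uniformity X := by
  rw [← nhdsSet_diagonal_eq_uniformity, mem_nhdsSet_iff_forall]
  rintro ⟨x, y⟩ (rfl : x = y)
  have hn := ((hQ.1 k _ (hA k x).1).isOpen.mem_nhds (hA k x).2)
  refine mem_of_superset (prod_mem_nhds hn hn) ?_
  rintro ⟨y, z⟩ ⟨hy, hz⟩
  exact (hQ.eq_of_mem (hA k y).1 (hA k x).1 (hA k y).2 hy).trans
    (hQ.eq_of_mem (hA k z).1 (hA k x).1 (hA k z).2 hz).symm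

lemma RefiningClopenPartitions.hasBasis_uniformity [CompactSpace X]
    (hQ : RefiningClopenPartitions Q) (hA : ∀ k x, A k x ∈ Q k ∧ x ∈ A k x) :
    (uniformity X).HasBasis (fun _ : ℕ => True) fun k => sameValue (A k) := by
  refine ⟨fun U => ⟨fun hU => ?_, fun ⟨k, _, hk⟩ =>
    mem_of_superset (hQ.sameValue_mem_uniformity hA k) hk⟩⟩
  obtain ⟨ε, hε, hU⟩ := Metric.mem_uniformity_dist.1 hU
  obtain ⟨K, hK⟩ := hQ.2.2.2.2 (ε / 2) (by positivity)
  refine ⟨K, trivial, ?_⟩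
  rintro ⟨x, y⟩ (h : A K x = A K y)
  refine hU ?_
  have hd := hK K le_rfl _ (hA K x).1
  have := Metric.dist_le_diam_of_mem ((isCompact_univ.isBounded).subset (Set.subset_univ (A K x)))
    (hA K x).2 (h ▸ (hA K y).2)
  linarith

end Partitions

lemma exists_log_coverMincard_le {X : Type*} (T : X → X) (U : SetRel X X)
    (hbot : coverEntropyEntourage T Set.univ U ≠ ⊥)
    (htop : coverEntropyEntourage T Set.univ U ≠ ⊤) {ε : ℝ} (hε : 0 < ε) :
    ∃ N : ℕ, ∀ n ≥ N, ENNReal.log (coverMincard T Set.univ U n) / n ≤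
      (((coverEntropyEntourage T Set.univ U).toReal + ε : ℝ) : EReal) := by
  have h : coverEntropyEntourage T Set.univ U <
      (((coverEntropyEntourage T Set.univ U).toReal + ε : ℝ) : EReal) := by
    conv_lhs => rw [← EReal.coe_toReal htop hbot]
    rw [EReal.coe_lt_coe_iff]
    linarith
  obtain ⟨N, hN⟩ := eventually_atTop.1 (eventually_lt_of_limsup_lt h)
  exact ⟨N, fun n hn => (hN n hn).le⟩

/-- The number of rectangles is bounded above in terms of the growth rate of dynamical covers. -/
lemma log_rectangles_le {X : Type*} [Nonempty X] {T : X ≃ X} {Q : Finset (Set X)} {F : Set X}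
    {a b : ℕ} {A : X → Set X} (hF : MarkerSet T F a b) (hb : 0 < b)
    (hA : ∀ x, A x ∈ Q ∧ x ∈ A x) (hAu : ∀ s ∈ Q, ∀ y ∈ s, s = A y) {c : ℝ}
    (hc : ENNReal.log (coverMincard T Set.univ (sameValue A) b) / b ≤ (c : EReal)) :
    (kRectangles T Q F).Finite ∧
      Real.log (Nat.card (kRectangles T Q F)) ≤ Real.log (b + 1) + b * c := by
  have hb0 : (0 : EReal) < (b : EReal) := by exact_mod_cast hb
  have hlog : ENNReal.log (coverMincard T Set.univ (sameValue A) b) ≤ ((b * c : ℝ) : EReal) := by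
    rw [EReal.div_le_iff_le_mul hb0 (EReal.natCast_ne_top b)] at hc
    push_cast
    exact_mod_cast hc
  have hlt : coverMincard T Set.univ (sameValue A) b < ⊤ := by
    have := hlog.trans_lt (EReal.coe_lt_top _)
    rw [ENNReal.log_lt_top_iff] at this
    exact_mod_cast this
  obtain ⟨s, hs, hcard⟩ := (coverMincard_finite_iff _ _ _ _).1 hlt
  obtain ⟨hfin, hle⟩ := kRectangles_finite_card_le hF hAu hs
  have hR := card_kRectangles_pos hF hA hfin
  have hspos : 0 < s.card := Nat.pos_of_mul_pos_left (hR.trans_le hle)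
  refine ⟨hfin, ?_⟩
  rw [← hcard] at hlog
  have hlog' : ((Real.log s.card : ℝ) : EReal) ≤ ((b * c : ℝ) : EReal) := by
    rw [← log_natCast_toENNReal hspos]
    exact_mod_cast hlog
  rw [EReal.coe_le_coe_iff] at hlog'
  have h1 : Real.log (Nat.card (kRectangles T Q F)) ≤ Real.log ((b + 1) * s.card) := by
    apply Real.log_le_log (by exact_mod_cast hR)
    exact_mod_cast hle
  rw [Real.log_mul (by positivity) (by positivity)] at h1
  linarith

/-- A real sequence squeezed between a monotone extended real sequence and a small perturbation of
it converges to its supremum. -/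
lemma tendsto_iSup_of_squeeze {E : ℕ → EReal} {x : ℕ → ℝ} {a b : ℕ → ℕ} (hE : Monotone E)
    (hE0 : ∀ k, 0 ≤ E k) (ha : Tendsto a atTop atTop) (hab : ∀ k, a k ≤ b k)
    (hba : Tendsto (fun k => (b k : ℝ) / (a k : ℝ)) atTop (nhds 1))
    (hlow : ∀ k, E k ≤ (x k : EReal))
    (hup : ∀ k, x k ≤ Real.log (b k + 1) / a k +
      (b k : ℝ) / a k * ((E k).toReal + 1 / ((k : ℝ) + 1))) :
    Tendsto (fun k => (x k : EReal)) atTop (nhds (⨆ k, E k)) := by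
  have hElim := tendsto_atTop_iSup hE
  by_cases htop : (⨆ k, E k) = ⊤
  · rw [htop] at hElim ⊢
    exact tendsto_nhds_top_mono' hElim hlow
  have hbot : (⨆ k, E k) ≠ ⊥ := by
    have : (0 : EReal) ≤ ⨆ k, E k := (hE0 0).trans (le_iSup E 0)
    rintro h
    simp [h] at this
  have hreal : Tendsto (fun k => (E k).toReal) atTop (nhds (⨆ k, E k).toReal) :=
    (EReal.tendsto_toReal htop hbot).comp hElim
  have haR : Tendsto (fun k => (a k : ℝ)) atTop atTop := tendsto_natCast_atTop_atTop.comp ha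
  have hbR : Tendsto (fun k => (b k : ℝ) + 1) atTop atTop :=
    tendsto_atTop_add_const_right _ _
      (tendsto_natCast_atTop_atTop.comp (tendsto_atTop_mono hab ha))
  have hlog : Tendsto (fun k => Real.log (b k + 1) / a k) atTop (nhds 0) := by
    have h1 := (Real.isLittleO_log_id_atTop.tendsto_div_nhds_zero.comp hbR).mul
      (hba.add haR.inv_tendsto_atTop)
    rw [zero_mul] at h1
    refine h1.congr' ?_
    filter_upwards [haR.eventually_gt_atTop 0] with k hk
    have : (0 : ℝ) < b k + 1 := by positivity
    simp only [Function.comp, id, Pi.inv_apply]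
    field_simp
  have hupper := hlog.add (hba.mul (hreal.add tendsto_one_div_add_atTop_nhds_zero_nat))
  rw [zero_add, one_mul, add_zero] at hupper
  have hupper' := EReal.tendsto_coe.2 hupper
  rw [EReal.coe_toReal htop hbot] at hupper'
  exact tendsto_of_tendsto_of_tendsto_of_le_of_le hElim hupper' hlow
    fun k => EReal.coe_le_coe_iff.2 (hup k)

theorem stmt_8 {X : Type*} [MetricSpace X] [CompactSpace X] [Nonempty X] (T : X ≃ₜ X)
    (hzero : ZeroDim X) (haper : Aperiodic' T.toEquiv)
    (Q : ℕ → Finset (Set X)) (hQ : RefiningClopenPartitions Q) :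
    ∃ N : ℕ → ℕ,
      ∀ (F : ℕ → Set X) (a b : ℕ → ℕ),
        (∀ k, IsClopen (F k)) → (∀ k, F (k + 1) ⊆ F k) →
        (∀ k, 0 < a k) → (∀ k, a k ≤ b k) →
        Tendsto a atTop atTop →
        Tendsto (fun k => (b k : ℝ) / (a k : ℝ)) atTop (nhds 1) →
        (∀ k, N k ≤ a k) →
        (∀ k, MarkerSet T.toEquiv (F k) (a k) (b k)) →
        ∃ h : EReal,
          Tendsto
            (fun k => ((Real.logb 2 (Nat.card (kRectangles T.toEquiv (Q k) (F k))) /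
              (a k : ℝ) : ℝ) : EReal)) atTop (nhds h) ∧
          (Real.log 2 : ℝ) * h = coverEntropy (⇑T) Set.univ := by
  choose A hA using hQ.exists_atom
  have hAu : ∀ k, ∀ s ∈ Q k, ∀ y ∈ s, s = A k y := fun k s hs y hy =>
    hQ.eq_of_mem hs (hA k y).1 hy (hA k y).2
  set E : ℕ → EReal := fun k => coverEntropyEntourage T Set.univ (sameValue (A k)) with hE
  have hE0 : ∀ k, 0 ≤ E k := fun k => coverEntropyEntourage_nonneg _ Set.univ_nonempty _
  have hEtop : ∀ k, E k ≠ ⊤ := fun k => (coverEntropyEntourage_finite_of_isCompact_invariant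
    isCompact_univ (Set.mapsTo_univ _ _) (hQ.sameValue_mem_uniformity hA k)).ne
  have hEbot : ∀ k, E k ≠ ⊥ := fun k h => by simpa [h] using hE0 k
  have hEmono : Monotone E := fun k l hkl =>
    coverEntropyEntourage_antitone T Set.univ (hQ.sameValue_antitone hA hkl)
  have hsup : coverEntropy (⇑T) Set.univ = ⨆ k, E k := by
    rw [coverEntropy_eq_iSup_basis (hQ.hasBasis_uniformity hA)]
    simp [hE]
  choose N hN using fun k => exists_log_coverMincard_le T (sameValue (A k)) (hEbot k) (hEtop k)
    (ε := 1 / ((k : ℝ) + 1)) (by positivity)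
  refine ⟨N, fun F a b _ _ ha hab hatop hba hNa hF => ?_⟩
  have hrect := fun k => log_rectangles_le (hF k) ((ha k).trans_le (hab k)) (hA k) (hAu k)
    (hN k (b k) ((hNa k).trans (hab k)))
  have hlim : Tendsto (fun k => ((Real.log (Nat.card (kRectangles T.toEquiv (Q k) (F k))) /
      (a k : ℝ) : ℝ) : EReal)) atTop (nhds (⨆ k, E k)) := by
    refine tendsto_iSup_of_squeeze hEmono hE0 hatop hab hba (fun k =>
      coverEntropyEntourage_le_log_rectangles (hF k) (ha k) (hA k) (hrect k).1) fun k => ?_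
    have hak : (0 : ℝ) < a k := by exact_mod_cast ha k
    rw [div_mul_eq_mul_div, ← add_div]
    exact div_le_div_of_nonneg_right (hrect k).2 hak.le
  have hlog2 : Real.log 2 ≠ 0 := (Real.log_pos one_lt_two).ne'
  refine ⟨((Real.log 2)⁻¹ : ℝ) * ⨆ k, E k, ?_, ?_⟩
  · have hmul := (EReal.continuousAt_mul (p := (((Real.log 2)⁻¹ : ℝ), ⨆ k, E k))
      (by simp [hlog2]) (by simp [hlog2]) (by simp) (by simp)).tendsto.comp
      ((tendsto_const_nhds (x := (((Real.log 2)⁻¹ : ℝ) : EReal))).prodMk_nhds hlim)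
    refine hmul.congr fun k => ?_
    simp only [Function.comp]
    rw [← EReal.coe_mul, EReal.coe_eq_coe_iff, Real.logb]
    field_simp
  · rw [hsup, ← mul_assoc, ← EReal.coe_mul, mul_inv_cancel₀ hlog2, EReal.coe_one, one_mul]
end

section
/- Let X ⊆ Λ^ℤ be a nonempty aperiodic subshift over a finite alphabet Λ (closed, shift-invariant, with no periodic points), with shift map T. Suppose clopen sets F_{k+1} ⊆ F_k ⊆ X and positive integers a_k ≤ b_k satisfy: a_k → ∞, b_k/a_k → 1, and for every x ∈ X and every k the visit set {n ∈ ℤ : Tⁿx ∈ F_k} is unbounded above and below with any two consecutive elements differing by at least a_k and at most b_k. For each k let R_k be the set of words x_0 x_1 ⋯ x_{ℓ−1} ∈ Λ^ℓ where x ∈ F_k and ℓ = min{n ≥ 1 : Tⁿx ∈ F_k} is the first return time of x to F_k. Then lim_{n→∞} (1/n) log₂ #B_n(X) = lim_{k→∞} (1/a_k) log₂ #R_k, where B_n(X) is the set of words of length n occurring in elements of X. -/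
open Filter

/-- The `n`-th iterate (`n ∈ ℤ`) of the shift map. -/
def shiftZ {Λ : Type*} (n : ℤ) (x : ℤ → Λ) : ℤ → Λ := fun m => x (m + n)

/-- The words of length `n` occurring in elements of `X`. -/
def wordsOf {Λ : Type*} (X : Set (ℤ → Λ)) (n : ℕ) : Set (Fin n → Λ) :=
  {w | ∃ x ∈ X, ∃ m : ℤ, ∀ i : Fin n, w i = x (m + (i : ℤ))}

/-- The `k`-rectangles: words read along first-return orbits of points of `F`. -/
def returnWords {Λ : Type*} (F : Set (ℤ → Λ)) : Set (Σ ℓ : ℕ, Fin ℓ → Λ) :=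
  {p | 1 ≤ p.1 ∧ ∃ x ∈ F, shiftZ (p.1 : ℤ) x ∈ F ∧
    (∀ j : ℤ, 1 ≤ j → j < (p.1 : ℤ) → shiftZ j x ∉ F) ∧
    ∀ i : Fin p.1, p.2 i = x (i : ℤ)}

theorem shiftZ_zero {Λ : Type*} (x : ℤ → Λ) : shiftZ 0 x = x := by
  funext j
  simp [shiftZ]

theorem Nat.card_coe_le_of_subset_range {α β : Type*} [Finite α] {s : Set β} (f : α → β)
    (h : s ⊆ Set.range f) : Nat.card s ≤ Nat.card α :=
  (Nat.card_mono (Set.finite_range f) h).trans (Finite.card_range_le f)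

/-- The words of length `n` read from the origin along points of `F`. -/
def initialWords {Λ : Type*} (F : Set (ℤ → Λ)) (n : ℕ) : Set (Fin n → Λ) :=
  {w | ∃ x ∈ F, ∀ i : Fin n, w i = x (i : ℤ)}

/-- Consecutive visits of the orbit of `x` to `F` surround every time `m`. -/
theorem exists_consecutive_visits {Λ : Type*} {F : Set (ℤ → Λ)} {x : ℤ → Λ}
    (hpos : ∀ N : ℤ, ∃ n : ℤ, N < n ∧ shiftZ n x ∈ F)
    (hneg : ∀ N : ℤ, ∃ n : ℤ, n < N ∧ shiftZ n x ∈ F) (m : ℤ) :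
    ∃ p q : ℤ, p ≤ m ∧ m < q ∧ shiftZ p x ∈ F ∧ shiftZ q x ∈ F ∧
      ∀ j : ℤ, p < j → j < q → shiftZ j x ∉ F := by
  obtain ⟨p, ⟨hpm, hp⟩, hpmax⟩ := Int.exists_greatest_of_bdd
    (P := fun z => z ≤ m ∧ shiftZ z x ∈ F) ⟨m, fun z hz => hz.1⟩
    (by obtain ⟨n, hn, h⟩ := hneg m; exact ⟨n, hn.le, h⟩)
  obtain ⟨q, ⟨hmq, hq⟩, hqmin⟩ := Int.exists_least_of_bdd
    (P := fun z => m < z ∧ shiftZ z x ∈ F) ⟨m, fun z hz => hz.1.le⟩ (hpos m)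
  refine ⟨p, q, hpm, hmq, hp, hq, fun j hpj hjq hj => ?_⟩
  rcases le_or_gt j m with h | h
  · exact absurd (hpmax j ⟨h, hj⟩) (by omega)
  · exact absurd (hqmin j ⟨h, hj⟩) (by omega)

theorem card_wordsOf_add_le {Λ : Type*} [Finite Λ] (X : Set (ℤ → Λ)) (m n : ℕ) :
    Nat.card (wordsOf X (m + n)) ≤ Nat.card (wordsOf X m) * Nat.card (wordsOf X n) := by
  rw [← Nat.card_prod]
  refine Nat.card_coe_le_of_subset_range
    (fun p : wordsOf X m × wordsOf X n => Fin.append p.1.1 p.2.1) ?_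
  rintro w ⟨x, hx, c, hw⟩
  refine ⟨(⟨fun i => w (Fin.castAdd n i), x, hx, c, fun i => hw _⟩,
    ⟨fun i => w (Fin.natAdd m i), x, hx, c + m, fun i => ?_⟩), Fin.append_castAdd_natAdd⟩
  dsimp only
  rw [hw]
  congr 1
  simp only [Fin.val_natAdd]
  push_cast
  ring

theorem wordsOf_nonempty {Λ : Type*} {X : Set (ℤ → Λ)} (hX : X.Nonempty) (n : ℕ) :
    (wordsOf X n).Nonempty :=
  let ⟨x, hx⟩ := hX
  ⟨fun i => x (0 + (i : ℤ)), x, hx, 0, fun _ => rfl⟩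

theorem card_wordsOf_pos {Λ : Type*} [Finite Λ] {X : Set (ℤ → Λ)} (hX : X.Nonempty) (n : ℕ) :
    0 < Nat.card (wordsOf X n) :=
  have := (wordsOf_nonempty hX n).to_subtype
  Nat.card_pos

theorem returnWords_subset_range {Λ : Type*} {X F : Set (ℤ → Λ)} (hFX : F ⊆ X) {b : ℕ}
    (hlen : ∀ p ∈ returnWords F, p.1 ≤ b) :
    returnWords F ⊆ Set.range (fun q : Fin (b + 1) × wordsOf X b =>
      (⟨q.1, fun i => q.2.1 (Fin.castLE (by omega) i)⟩ : Σ ℓ : ℕ, Fin ℓ → Λ)) := by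
  rintro ⟨ℓ, w⟩ hp
  have hℓ : ℓ ≤ b := hlen _ hp
  obtain ⟨-, x, hx, -, -, hw⟩ := hp
  refine ⟨(⟨ℓ, by omega⟩, ⟨fun i => x (0 + (i : ℤ)), x, hFX hx, 0, fun _ => rfl⟩), ?_⟩
  simp only [Sigma.mk.injEq, heq_eq_eq, true_and]
  funext i
  simpa using (hw i).symm

theorem card_returnWords_le {Λ : Type*} [Finite Λ] {X F : Set (ℤ → Λ)} (hFX : F ⊆ X) {b : ℕ}
    (hlen : ∀ p ∈ returnWords F, p.1 ≤ b) :
    Nat.card (returnWords F) ≤ (b + 1) * Nat.card (wordsOf X b) := by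
  have := Nat.card_coe_le_of_subset_range _ (returnWords_subset_range hFX hlen)
  rwa [Nat.card_prod, Nat.card_fin] at this

/-- An initial word starts with a return word, after which an initial word follows. -/
theorem card_initialWords_add_le {Λ : Type*} [Finite Λ] [Inhabited Λ] {F : Set (ℤ → Λ)} {a : ℕ}
    (hfin : (returnWords F).Finite)
    (hret : ∀ x ∈ F, ∃ ℓ : ℕ, a ≤ ℓ ∧ 1 ≤ ℓ ∧ shiftZ (ℓ : ℤ) x ∈ F ∧
      ∀ j : ℤ, 1 ≤ j → j < (ℓ : ℤ) → shiftZ j x ∉ F) (n : ℕ) :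
    Nat.card (initialWords F (n + a)) ≤
      Nat.card (returnWords F) * Nat.card (initialWords F n) := by
  have := hfin.to_subtype
  rw [← Nat.card_prod]
  refine Nat.card_coe_le_of_subset_range
    (fun p : returnWords F × initialWords F n => fun i : Fin (n + a) =>
      if h : (i : ℕ) < p.1.1.1 then p.1.1.2 ⟨i, h⟩
      else if h : (i : ℕ) - p.1.1.1 < n then p.2.1 ⟨i - p.1.1.1, h⟩ else default) ?_
  rintro w ⟨x, hx, hw⟩
  obtain ⟨ℓ, haℓ, hℓ, hxℓ, hbetween⟩ := hret x hx
  refine ⟨(⟨⟨ℓ, fun i => x (i : ℤ)⟩, hℓ, x, hx, hxℓ, hbetween, fun _ => rfl⟩,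
    ⟨fun i => shiftZ (ℓ : ℤ) x (i : ℤ), _, hxℓ, fun _ => rfl⟩), ?_⟩
  funext i
  rw [hw]
  have hi := i.isLt
  dsimp only
  split_ifs with h₁ h₂
  · rfl
  · simp only [shiftZ]
    congr 1
    omega
  · omega

theorem card_initialWords_mul_le {Λ : Type*} [Finite Λ] [Inhabited Λ] {F : Set (ℤ → Λ)} {a : ℕ}
    (hfin : (returnWords F).Finite)
    (hret : ∀ x ∈ F, ∃ ℓ : ℕ, a ≤ ℓ ∧ 1 ≤ ℓ ∧ shiftZ (ℓ : ℤ) x ∈ F ∧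
      ∀ j : ℤ, 1 ≤ j → j < (ℓ : ℤ) → shiftZ j x ∉ F) (N : ℕ) :
    Nat.card (initialWords F (N * a)) ≤ Nat.card (returnWords F) ^ N := by
  induction N with
  | zero =>
    rw [pow_zero, Nat.zero_mul]
    exact Finite.card_le_one_iff_subsingleton.2 inferInstance
  | succ N ih =>
    rw [Nat.succ_mul, pow_succ']
    exact (card_initialWords_add_le hfin hret _).trans (Nat.mul_le_mul_left _ ih)

/-- A word occurs inside an initial word, at an offset less than the bound `b` on gaps. -/
theorem card_wordsOf_le_mul_card_initialWords {Λ : Type*} [Finite Λ] {X F : Set (ℤ → Λ)} {b : ℕ}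
    (hback : ∀ x ∈ X, ∀ m : ℤ, ∃ p : ℤ, p ≤ m ∧ m < p + b ∧ shiftZ p x ∈ F)
    {n n' : ℕ} (hn : n + b ≤ n') :
    Nat.card (wordsOf X n) ≤ b * Nat.card (initialWords F n') := by
  suffices h : wordsOf X n ⊆ Set.range (fun q : Fin b × initialWords F n' =>
      fun i : Fin n => q.2.1 ⟨q.1 + i, by omega⟩) by
    have := Nat.card_coe_le_of_subset_range _ h
    rwa [Nat.card_prod, Nat.card_fin] at this
  rintro w ⟨x, hx, m, hw⟩
  obtain ⟨p, hpm, hmp, hp⟩ := hback x hx m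
  refine ⟨(⟨(m - p).toNat, by omega⟩,
    ⟨fun i => shiftZ p x (i : ℤ), _, hp, fun _ => rfl⟩), ?_⟩
  funext i
  rw [hw]
  simp only [shiftZ]
  congr 1
  omega

theorem tendsto_logb_succ_div_atTop :
    Tendsto (fun n : ℕ => Real.logb 2 ((n : ℝ) + 1) / n) atTop (nhds 0) := by
  have h₁ : Tendsto (fun n : ℕ => (n : ℝ) + 1) atTop atTop :=
    tendsto_atTop_add_const_right _ _ tendsto_natCast_atTop_atTop
  have h₂ := ((Real.tendsto_pow_log_div_mul_add_atTop 1 (-1) 1 one_ne_zero).comp h₁).div_const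
    (Real.log 2)
  rw [zero_div] at h₂
  refine h₂.congr fun n => ?_
  simp only [Function.comp_apply, pow_one, one_mul, add_neg_cancel_right, Real.logb]
  ring

theorem exists_tendsto_logb_card_wordsOf {Λ : Type*} [Finite Λ] {X : Set (ℤ → Λ)}
    (hX : X.Nonempty) :
    ∃ h : ℝ, Tendsto (fun n : ℕ => Real.logb 2 (Nat.card (wordsOf X n)) / (n : ℝ))
      atTop (nhds h) := by
  have hsub : Subadditive (fun n : ℕ => Real.logb 2 (Nat.card (wordsOf X n))) := by
    intro m n
    have hm : (0 : ℝ) < Nat.card (wordsOf X m) := mod_cast card_wordsOf_pos hX m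
    have hn : (0 : ℝ) < Nat.card (wordsOf X n) := mod_cast card_wordsOf_pos hX n
    have hmn : (0 : ℝ) < Nat.card (wordsOf X (m + n)) := mod_cast card_wordsOf_pos hX (m + n)
    rw [← Real.logb_mul hm.ne' hn.ne']
    exact Real.logb_le_logb_of_le one_lt_two hmn (mod_cast card_wordsOf_add_le X m n)
  refine ⟨_, hsub.tendsto_lim ⟨0, ?_⟩⟩
  rintro _ ⟨n, rfl⟩
  have hn : (1 : ℝ) ≤ Nat.card (wordsOf X n) := mod_cast card_wordsOf_pos hX n
  exact div_nonneg (Real.logb_nonneg one_lt_two hn) n.cast_nonneg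

/-- If the words of length `N * a` number at most `b * r ^ (N + c)`, then the entropy is at most
`log₂ r / a`. -/
theorem le_logb_div_of_card_le {u : ℕ → ℕ} (hu : ∀ n, 0 < u n) {h : ℝ}
    (hlim : Tendsto (fun n : ℕ => Real.logb 2 (u n) / (n : ℝ)) atTop (nhds h))
    {a b c r : ℕ} (ha : 0 < a) (hle : ∀ N, u (N * a) ≤ b * r ^ (N + c)) :
    h ≤ Real.logb 2 r / a := by
  have hbr : b ≠ 0 ∧ r ≠ 0 := by
    have := (hu _).trans_le (hle 1)
    constructor <;> rintro rfl <;> simp at this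
  have ha' : (a : ℝ) ≠ 0 := mod_cast ha.ne'
  have hb' : (b : ℝ) ≠ 0 := mod_cast hbr.1
  have hr' : (r : ℝ) ≠ 0 := mod_cast hbr.2
  have hleft := hlim.comp (tendsto_id.atTop_mul_const' ha)
  have hright : Tendsto (fun N : ℕ => Real.logb 2 r / a +
      (Real.logb 2 b + c * Real.logb 2 r) / a / (N : ℝ)) atTop (nhds (Real.logb 2 r / a)) := by
    simpa using (tendsto_const_div_atTop_nhds_zero_nat
      ((Real.logb 2 b + c * Real.logb 2 r) / a)).const_add (Real.logb 2 r / a)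
  refine le_of_tendsto_of_tendsto hleft hright ?_
  filter_upwards [eventually_gt_atTop 0] with N hN
  have hN' : (N : ℝ) ≠ 0 := mod_cast hN.ne'
  have hlog : Real.logb 2 (u (N * a)) ≤ Real.logb 2 b + (N + c) * Real.logb 2 r := by
    have h₀ : (0 : ℝ) < u (N * a) := mod_cast hu _
    have h₁ : (u (N * a) : ℝ) ≤ b * (r : ℝ) ^ (N + c) := mod_cast hle N
    have h₂ := Real.logb_le_logb_of_le one_lt_two h₀ h₁
    rw [Real.logb_mul hb' (pow_ne_zero _ hr'), Real.logb_pow] at h₂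
    exact_mod_cast h₂
  calc Real.logb 2 (u (N * a)) / ((N * a : ℕ) : ℝ)
      ≤ (Real.logb 2 b + (N + c) * Real.logb 2 r) / ((N * a : ℕ) : ℝ) := by gcongr
    _ = _ := by
      push_cast
      field_simp
      ring

theorem logb_card_returnWords_le {Λ : Type*} [Finite Λ] {X F : Set (ℤ → Λ)}
    (hX : X.Nonempty) (hFX : F ⊆ X) {b : ℕ} (hlen : ∀ p ∈ returnWords F, p.1 ≤ b) :
    Real.logb 2 (Nat.card (returnWords F)) ≤
      Real.logb 2 ((b : ℝ) + 1) + Real.logb 2 (Nat.card (wordsOf X b)) := by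
  have hB : (1 : ℝ) ≤ Nat.card (wordsOf X b) := mod_cast card_wordsOf_pos hX b
  have hb : (1 : ℝ) ≤ (b : ℝ) + 1 := by linarith [b.cast_nonneg (α := ℝ)]
  rcases Nat.eq_zero_or_pos (Nat.card (returnWords F)) with h | h
  · rw [h, Nat.cast_zero, Real.logb_zero]
    exact add_nonneg (Real.logb_nonneg one_lt_two hb) (Real.logb_nonneg one_lt_two hB)
  · rw [← Real.logb_mul (by positivity) (by positivity)]
    exact Real.logb_le_logb_of_le one_lt_two (mod_cast h)
      (mod_cast card_returnWords_le hFX hlen)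

theorem stmt_9 {Λ : Type} [Fintype Λ] [TopologicalSpace Λ] [DiscreteTopology Λ]
    (X : Set (ℤ → Λ))
    (hX : X.Nonempty) (hXcl : IsClosed X) (hXinv : ∀ x, x ∈ X ↔ shiftMap x ∈ X)
    (haper : ∀ x ∈ X, ∀ n : ℕ, 1 ≤ n → shiftZ (n : ℤ) x ≠ x)
    (F : ℕ → Set (ℤ → Λ)) (a b : ℕ → ℕ)
    (hFX : ∀ k, F k ⊆ X)
    (hFclopen : ∀ k, IsClopen (Subtype.val ⁻¹' F k : Set ↥X))
    (hFnest : ∀ k, F (k + 1) ⊆ F k)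
    (ha : ∀ k, 0 < a k) (hab : ∀ k, a k ≤ b k)
    (haTop : Tendsto a atTop atTop)
    (hbal : Tendsto (fun k => (b k : ℝ) / (a k : ℝ)) atTop (nhds 1))
    (hmark : ∀ x ∈ X, ∀ k : ℕ,
      (∀ N : ℤ, ∃ n : ℤ, N < n ∧ shiftZ n x ∈ F k) ∧
      (∀ N : ℤ, ∃ n : ℤ, n < N ∧ shiftZ n x ∈ F k) ∧
      (∀ m n : ℤ, m < n → shiftZ m x ∈ F k → shiftZ n x ∈ F k →
        (∀ j : ℤ, m < j → j < n → shiftZ j x ∉ F k) →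
        (a k : ℤ) ≤ n - m ∧ n - m ≤ (b k : ℤ))) :
    ∃ h : ℝ,
      Tendsto (fun n : ℕ => Real.logb 2 (Nat.card (wordsOf X n)) / (n : ℝ))
        atTop (nhds h) ∧
      Tendsto (fun k : ℕ => Real.logb 2 (Nat.card (returnWords (F k))) / (a k : ℝ))
        atTop (nhds h) := by
  obtain ⟨h, hh⟩ := exists_tendsto_logb_card_wordsOf hX
  have : Inhabited Λ := ⟨hX.some 0⟩
  have hlen : ∀ k, ∀ p ∈ returnWords (F k), p.1 ≤ b k := by
    rintro k ⟨ℓ, w⟩ ⟨hℓ, x, hx, hxℓ, hbetween, -⟩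
    have := (hmark x (hFX k hx) k).2.2 0 ℓ (by dsimp only at hℓ; omega)
      (by rwa [shiftZ_zero]) hxℓ (fun j hj hjℓ => hbetween j (by omega) hjℓ)
    dsimp only
    omega
  have hret : ∀ k, ∀ x ∈ F k, ∃ ℓ : ℕ, a k ≤ ℓ ∧ 1 ≤ ℓ ∧ shiftZ (ℓ : ℤ) x ∈ F k ∧
      ∀ j : ℤ, 1 ≤ j → j < (ℓ : ℤ) → shiftZ j x ∉ F k := by
    intro k x hx
    obtain ⟨hpos, hneg, hgap⟩ := hmark x (hFX k hx) k
    obtain ⟨p, q, hp, hq, hpF, hqF, hbetween⟩ := exists_consecutive_visits hpos hneg 0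
    obtain rfl : p = 0 := by
      by_contra hne
      exact hbetween 0 (by omega) hq (by rwa [shiftZ_zero])
    have := hgap 0 q hq hpF hqF hbetween
    lift q to ℕ using hq.le
    exact ⟨q, by omega, by omega, hqF, fun j hj hjq => hbetween j (by omega) hjq⟩
  have hback : ∀ k, ∀ x ∈ X, ∀ m : ℤ, ∃ p : ℤ, p ≤ m ∧ m < p + b k ∧ shiftZ p x ∈ F k := by
    intro k x hx m
    obtain ⟨hpos, hneg, hgap⟩ := hmark x hx k
    obtain ⟨p, q, hp, hq, hpF, hqF, hbetween⟩ := exists_consecutive_visits hpos hneg m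
    have := hgap p q (by omega) hpF hqF hbetween
    exact ⟨p, hp, by omega, hpF⟩
  have hbTop : Tendsto b atTop atTop := tendsto_atTop_mono hab haTop
  have hupper : Tendsto (fun k => (Real.logb 2 ((b k : ℝ) + 1) / b k +
      Real.logb 2 (Nat.card (wordsOf X (b k))) / b k) * ((b k : ℝ) / a k)) atTop (nhds h) := by
    simpa using ((tendsto_logb_succ_div_atTop.comp hbTop).add (hh.comp hbTop)).mul hbal
  refine ⟨h, hh, tendsto_of_tendsto_of_tendsto_of_le_of_le tendsto_const_nhds hupper ?_ ?_⟩
  · intro k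
    have hfin : (returnWords (F k)).Finite :=
      (Set.finite_range _).subset (returnWords_subset_range (hFX k) (hlen k))
    refine le_logb_div_of_card_le (card_wordsOf_pos hX) hh (ha k) (b := b k) (c := b k)
      fun N => ?_
    refine (card_wordsOf_le_mul_card_initialWords (hback k) (n' := (N + b k) * a k) ?_).trans
      (Nat.mul_le_mul_left _ (card_initialWords_mul_le hfin (hret k) _))
    nlinarith [ha k]
  · intro k
    have ha' : (a k : ℝ) ≠ 0 := mod_cast (ha k).ne'
    have hb' : (b k : ℝ) ≠ 0 := mod_cast ((ha k).trans_le (hab k)).ne'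
    calc Real.logb 2 (Nat.card (returnWords (F k))) / (a k : ℝ)
        ≤ (Real.logb 2 ((b k : ℝ) + 1) + Real.logb 2 (Nat.card (wordsOf X (b k)))) / a k := by
          gcongr
          exact logb_card_returnWords_le hX (hFX k) (hlen k)
      _ = _ := by field_simp
end

section
/- (Vertical data compression of zero-dimensional systems.) Let (X,T) be an aperiodic zero-dimensional topological dynamical system (X a nonempty compact metric space with a basis of clopen sets, T : X → X a homeomorphism with no periodic points). Then (X,T) is topologically conjugate to a subshift over the countable compact alphabet ℕ ∪ {∞} (the one-point compactification of the discrete space ℕ): there is a nonempty closed subset Y of (ℕ ∪ {∞})^ℤ (product topology) invariant under the shift S, (Sy)_n = y_{n+1}, such that (X,T) is topologically conjugate to (Y,S). -/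
open TopologicalSpace

open Set Topology

section Markers

variable {X : Type*} [TopologicalSpace X] (T : X ≃ₜ X)

/-- A set meets every orbit of `T`. -/
def MeetsOrbits (U : Set X) : Prop :=
  ∀ x, ∃ n : ℤ, (T ^ n) x ∈ U

/-- Distinct visits of an orbit to `V` are more than `L` steps apart. -/
def IsSparse (L : ℕ) (V : Set X) : Prop :=
  ∀ x ∈ V, ∀ j ∈ Finset.Icc (-L : ℤ) L, j ≠ 0 → (T ^ j) x ∉ V

variable {T}

theorem homeomorph_zpow_add_apply (m n : ℤ) (x : X) : (T ^ m) ((T ^ n) x) = (T ^ (m + n)) x := by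
  rw [zpow_add]; rfl

theorem homeomorph_zpow_neg_apply (n : ℤ) (x : X) : (T ^ (-n)) ((T ^ n) x) = x := by
  rw [homeomorph_zpow_add_apply, neg_add_cancel, zpow_zero]; rfl

theorem IsClopen.preimage_zpow {V : Set X} (hV : IsClopen V) (n : ℤ) :
    IsClopen {x | (T ^ n) x ∈ V} :=
  hV.preimage (T ^ n).continuous

theorem zpow_apply_ne_of_aperiodic (h : Aperiodic' T.toEquiv) (x : X) {n : ℤ} (hn : n ≠ 0) :
    (T ^ n) x ≠ x := by
  have key : ∀ (m : ℕ) (y : X), (T ^ m) y = (T.toEquiv ^ m) y := by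
    intro m
    induction m with
    | zero => intro y; rfl
    | succ k ih => intro y; rw [pow_succ, pow_succ]; exact ih (T y)
  intro hx
  obtain ⟨m, rfl | rfl⟩ := n.eq_nat_or_neg
  · refine h x m (by lia) ?_
    rw [← key, ← zpow_natCast, hx]
  · refine h x m (by lia) ?_
    rw [← key, ← zpow_natCast]
    conv_lhs => rw [← hx]
    simp

theorem MeetsOrbits.exists_bound [CompactSpace X] {U : Set X} (hU : IsClopen U)
    (h : MeetsOrbits T U) : ∃ N : ℕ, ∀ x, ∃ n ∈ Finset.Icc (-N : ℤ) N, (T ^ n) x ∈ U := by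
  obtain ⟨t, ht⟩ := isCompact_univ.elim_finite_subcover (fun n : ℤ => {x | (T ^ n) x ∈ U})
    (fun n => (hU.preimage_zpow n).isOpen) (fun x _ => mem_iUnion.2 (h x))
  refine ⟨t.sup Int.natAbs, fun x => ?_⟩
  obtain ⟨n, hn, hx⟩ := mem_iUnion₂.1 (ht (mem_univ x))
  have : n.natAbs ≤ t.sup Int.natAbs := Finset.le_sup (f := Int.natAbs) hn
  exact ⟨n, Finset.mem_Icc.2 (by lia), hx⟩

theorem exists_isClopen_isSparse_mem [T2Space X] [CompactSpace X] [TotallyDisconnectedSpace X]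
    (haper : Aperiodic' T.toEquiv) (L : ℕ) {U : Set X} (hU : IsClopen U) {x : X} (hx : x ∈ U) :
    ∃ C ⊆ U, IsClopen C ∧ x ∈ C ∧ IsSparse T L C := by
  have hsep : ∀ j : ℤ, ∃ A : Set X, IsClopen A ∧ x ∈ A ∧ (j ≠ 0 → (T ^ j) x ∉ A) := by
    intro j
    by_cases hj : j = 0
    · exact ⟨univ, isClopen_univ, mem_univ x, fun h => absurd hj h⟩
    · obtain ⟨A, hA, hxA, hAj⟩ := compact_exists_isClopen_in_isOpen
        (isOpen_compl_singleton (x := (T ^ j) x))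
        (show x ∈ ({(T ^ j) x} : Set X)ᶜ from (zpow_apply_ne_of_aperiodic haper x hj).symm)
      exact ⟨A, hA, hxA, fun _ h => hAj h rfl⟩
  choose A hA hxA hAj using hsep
  refine ⟨U ∩ ⋂ j ∈ Finset.Icc (-L : ℤ) L, A j ∩ {y | j ≠ 0 → (T ^ j) y ∉ A j},
    inter_subset_left, hU.inter (isClopen_biInter_finset fun j _ => (hA j).inter ?_), ?_, ?_⟩
  · by_cases hj : j = 0
    · simp [hj, isClopen_univ]
    · convert ((hA j).preimage_zpow (T := T) j).compl using 1
      ext y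
      simp [hj]
  · exact ⟨hx, mem_iInter₂.2 fun j _ => ⟨hxA j, hAj j⟩⟩
  · intro y hy j hj hj0 hyj
    exact (mem_iInter₂.1 hy.2 j hj).2 hj0 (mem_iInter₂.1 hyj.2 j hj).1

theorem exists_isClopen_isSparse [T2Space X] [CompactSpace X] [TotallyDisconnectedSpace X]
    (haper : Aperiodic' T.toEquiv) (L : ℕ) {U : Set X} (hU : IsClopen U) :
    ∃ V ⊆ U, IsClopen V ∧ IsSparse T L V ∧ ∀ x ∈ U, ∃ n : ℤ, (T ^ n) x ∈ V := by
  refine hU.isClosed.isCompact.induction_on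
    (p := fun s => ∃ V ⊆ U, IsClopen V ∧ IsSparse T L V ∧ ∀ x ∈ s, ∃ n : ℤ, (T ^ n) x ∈ V)
    ⟨∅, empty_subset U, isClopen_empty, fun x hx => hx.elim, fun x hx => hx.elim⟩ ?_ ?_ ?_
  · rintro s t hst ⟨V, hVU, hV, hVL, ht⟩
    exact ⟨V, hVU, hV, hVL, fun x hx => ht x (hst hx)⟩
  · rintro s t ⟨V, hVU, hV, hVL, hs⟩ ⟨V', hVU', hV', hVL', ht⟩
    set W : Set X := ⋃ j ∈ Finset.Icc (-L : ℤ) L, {y | (T ^ j) y ∈ V} with hW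
    have hWc : IsClopen W := isClopen_biUnion_finset fun j _ => hV.preimage_zpow j
    refine ⟨V ∪ V' \ W, union_subset hVU (sdiff_subset.trans hVU'), hV.union (hV'.diff hWc), ?_, ?_⟩
    · rintro x (hx | hx) j hj hj0 (hxj | hxj)
      · exact hVL x hx j hj hj0 hxj
      · refine hxj.2 (mem_iUnion₂.2 ⟨-j, ?_, ?_⟩)
        · rw [Finset.mem_Icc] at hj ⊢; lia
        · rwa [mem_ofPred_eq, homeomorph_zpow_neg_apply]
      · exact hx.2 (mem_iUnion₂.2 ⟨j, hj, hxj⟩)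
      · exact hVL' x hx.1 j hj hj0 hxj.1
    · rintro x (hx | hx)
      · obtain ⟨n, hn⟩ := hs x hx
        exact ⟨n, Or.inl hn⟩
      · obtain ⟨n, hn⟩ := ht x hx
        by_cases hnW : (T ^ n) x ∈ W
        · obtain ⟨j, -, hj⟩ := mem_iUnion₂.1 hnW
          rw [mem_ofPred_eq, homeomorph_zpow_add_apply] at hj
          exact ⟨j + n, Or.inl hj⟩
        · exact ⟨n, Or.inr ⟨hn, hnW⟩⟩
  · intro x hx
    obtain ⟨C, hCU, hC, hxC, hCL⟩ := exists_isClopen_isSparse_mem haper L hU hx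
    exact ⟨C, mem_nhdsWithin_of_mem_nhds (hC.isOpen.mem_nhds hxC), C, hCU, hC, hCL,
      fun y hy => ⟨0, hy⟩⟩

theorem MeetsOrbits.exists_split [T2Space X] [CompactSpace X] [TotallyDisconnectedSpace X]
    (haper : Aperiodic' T.toEquiv) {U : Set X} (hU : IsClopen U) (h : MeetsOrbits T U) :
    ∃ V ⊆ U, IsClopen V ∧ MeetsOrbits T V ∧ MeetsOrbits T (U \ V) := by
  obtain ⟨N, hN⟩ := h.exists_bound hU
  obtain ⟨V, hVU, hV, hVL, hcov⟩ := exists_isClopen_isSparse haper (2 * N + 1) hU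
  refine ⟨V, hVU, hV, fun x => ?_, fun x => ?_⟩
  · obtain ⟨n, hn⟩ := h x
    obtain ⟨m, hm⟩ := hcov _ hn
    exact ⟨m + n, by rwa [← homeomorph_zpow_add_apply]⟩
  · obtain ⟨n, hn⟩ := h x
    by_cases hnV : (T ^ n) x ∈ V
    · obtain ⟨m, hm, hmU⟩ := hN ((T ^ (N + 1 : ℤ)) ((T ^ n) x))
      rw [homeomorph_zpow_add_apply] at hmU
      rw [Finset.mem_Icc] at hm
      refine ⟨m + (N + 1) + n, ?_⟩
      rw [← homeomorph_zpow_add_apply]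
      exact ⟨hmU, hVL _ hnV _ (Finset.mem_Icc.2 (by push_cast; lia)) (by lia)⟩
    · exact ⟨n, hn, hnV⟩

theorem exists_disjoint_isClopen_meetsOrbits [T2Space X] [CompactSpace X]
    [TotallyDisconnectedSpace X] (haper : Aperiodic' T.toEquiv) :
    ∃ G : ℕ → Set X, (∀ k, IsClopen (G k)) ∧ (∀ k, MeetsOrbits T (G k)) ∧
      Pairwise (Function.onFun Disjoint G) := by
  let P := {U : Set X // IsClopen U ∧ MeetsOrbits T U}
  have hsplit : ∀ U : P, ∃ V : P, V.1 ⊆ U.1 ∧ MeetsOrbits T (U.1 \ V.1) := by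
    rintro ⟨U, hU, h⟩
    obtain ⟨V, hVU, hV, hVT, hUV⟩ := h.exists_split haper hU
    exact ⟨⟨V, hV, hVT⟩, hVU, hUV⟩
  choose next hnext hdiff using hsplit
  let U : ℕ → P := fun k => next^[k] ⟨univ, isClopen_univ, fun x => ⟨0, mem_univ _⟩⟩
  have hsucc : ∀ k, U (k + 1) = next (U k) := fun k => Function.iterate_succ_apply' _ _ _
  have hanti : Antitone fun k => (U k).1 :=
    antitone_nat_of_succ_le fun k => by rw [hsucc]; exact hnext _
  refine ⟨fun k => (U k).1 \ (U (k + 1)).1, fun k => (U k).2.1.diff (U (k + 1)).2.1,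
    fun k => by simpa only [hsucc] using hdiff (U k), ?_⟩
  refine (pairwise_disjoint_on _).2 fun m n hmn => ?_
  exact disjoint_left.2 fun x hxm hxn => hxm.2 (hanti (Nat.succ_le_of_lt hmn) hxn.1)

end Markers

theorem preimage_eq_biUnion_of_infty_notMem {X : Type*} (f : X → OnePoint ℕ)
    {s : Set (OnePoint ℕ)} (hs : OnePoint.infty ∉ s) :
    f ⁻¹' s = ⋃ n ∈ ((↑) ⁻¹' s : Set ℕ), f ⁻¹' {(n : OnePoint ℕ)} := by
  ext x
  simp only [mem_preimage, mem_iUnion, mem_singleton_iff, exists_prop]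
  constructor
  · intro hx
    obtain ⟨n, hn⟩ := OnePoint.ne_infty_iff_exists.1 (ne_of_mem_of_not_mem hx hs)
    exact ⟨n, by rwa [hn], hn.symm⟩
  · rintro ⟨n, hn, hx⟩
    rwa [hx]

theorem continuous_onePoint_nat {X : Type*} [TopologicalSpace X] {f : X → OnePoint ℕ}
    (h : ∀ n : ℕ, IsClopen (f ⁻¹' {(n : OnePoint ℕ)})) : Continuous f := by
  refine continuous_def.2 fun s hs => ?_
  by_cases hinf : OnePoint.infty ∈ s
  · have hfin : ((↑) ⁻¹' sᶜ : Set ℕ).Finite :=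
      ((OnePoint.isOpen_def.1 hs).1 hinf).finite_of_discrete
    rw [← isClosed_compl_iff, ← preimage_compl,
      preimage_eq_biUnion_of_infty_notMem f (notMem_compl_iff.2 hinf)]
    exact hfin.isClosed_biUnion fun n _ => (h n).isClosed
  · rw [preimage_eq_biUnion_of_infty_notMem f hinf]
    exact isOpen_biUnion fun n _ => (h n).isOpen

/-- Countably many continuous integer codes, living on disjoint clopen sets, can be glued to one
continuous map with values in `OnePoint ℕ`. -/
theorem exists_continuous_onePoint_of_disjoint {X : Type*} [TopologicalSpace X] {G : ℕ → Set X}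
    (hG : ∀ k, IsClopen (G k)) (hdisj : Pairwise (Function.onFun Disjoint G)) {c : ℕ → X → ℕ}
    (hc : ∀ k, Continuous (c k)) :
    ∃ f : X → OnePoint ℕ, Continuous f ∧
      ∀ x k m, f x = (Nat.pair k m : ℕ) ↔ x ∈ G k ∧ c k x = m := by
  classical
  let f : X → OnePoint ℕ := fun x =>
    if h : ∃ k, x ∈ G k then ((Nat.pair h.choose (c h.choose x) : ℕ) : OnePoint ℕ)
    else OnePoint.infty
  have hf : ∀ x k m, f x = (Nat.pair k m : ℕ) ↔ x ∈ G k ∧ c k x = m := by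
    intro x k m
    by_cases h : ∃ k, x ∈ G k
    · simp only [f, dif_pos h, OnePoint.coe_eq_coe, Nat.pair_eq_pair]
      have hmem := h.choose_spec
      constructor
      · rintro ⟨rfl, hm⟩
        exact ⟨hmem, hm⟩
      · rintro ⟨hk, hm⟩
        have hkk : h.choose = k := by
          by_contra hne
          exact disjoint_left.1 (hdisj hne) hmem hk
        rw [hkk]
        exact ⟨rfl, hm⟩
    · simp only [f, dif_neg h]
      exact ⟨fun h' => absurd h' (OnePoint.infty_ne_coe _), fun h' => absurd ⟨k, h'.1⟩ h⟩
  refine ⟨f, continuous_onePoint_nat fun n => ?_, hf⟩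
  have heq : f ⁻¹' {(n : OnePoint ℕ)} = G n.unpair.1 ∩ c n.unpair.1 ⁻¹' {n.unpair.2} := by
    ext x
    simpa using hf x n.unpair.1 n.unpair.2
  rw [heq]
  exact (hG _).inter ((isClopen_discrete _).preimage (hc _))

theorem exists_continuous_nat_code {X ι : Type*} [TopologicalSpace X] [Finite ι] {B : ι → Set X}
    (hB : ∀ i, IsClopen (B i)) :
    ∃ c : X → ℕ, Continuous c ∧ ∀ x y, c x = c y → ∀ i, x ∈ B i ↔ y ∈ B i := by
  classical
  obtain ⟨e, he⟩ := exists_injective_nat (ι → Bool)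
  refine ⟨fun x => e fun i => decide (x ∈ B i), continuous_of_discreteTopology.comp
    (continuous_pi fun i => (continuous_bool_rng true).2 ?_), fun x y hxy i => ?_⟩
  · convert hB i using 1
    ext x
    simp
  · simpa using congrFun (he hxy) i

theorem ZeroDim.totallyDisconnectedSpace {X : Type*} [TopologicalSpace X] [T1Space X]
    (h : ZeroDim X) : TotallyDisconnectedSpace X := by
  obtain ⟨B, hB, hbasis⟩ := h
  have : TotallySeparatedSpace X := totallySeparatedSpace_iff_exists_isClopen.2 fun x y hxy => by
    obtain ⟨U, hU, hx, hUy⟩ := hbasis.exists_subset_of_mem_open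
      (show x ∈ ({y} : Set X)ᶜ from hxy) isOpen_compl_singleton
    exact ⟨U, hB U hU, hx, fun hy => hUy hy rfl⟩
  infer_instance

theorem exists_seq_isClopen_separating (X : Type*) [TopologicalSpace X] [T2Space X] [CompactSpace X]
    [SecondCountableTopology X] [TotallyDisconnectedSpace X] :
    ∃ B : ℕ → Set X, (∀ k, IsClopen (B k)) ∧ ∀ x y, x ≠ y → ∃ k, x ∈ B k ∧ y ∉ B k := by
  have : Countable (Clopens X) := Clopens.countable_iff_secondCountable.2 inferInstance
  obtain ⟨e, he⟩ := exists_surjective_nat (Clopens X)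
  refine ⟨fun k => e k, fun k => (e k).isClopen, fun x y hxy => ?_⟩
  obtain ⟨A, hA, hxA, hAy⟩ := compact_exists_isClopen_in_isOpen
    (isOpen_compl_singleton (x := y)) (show x ∈ ({y} : Set X)ᶜ from hxy)
  obtain ⟨k, hk⟩ := he ⟨A, hA⟩
  refine ⟨k, ?_⟩
  simp only [hk]
  exact ⟨hxA, fun hy => hAy hy rfl⟩

/-- An aperiodic zero-dimensional system has a one-symbol generator over `OnePoint ℕ`. -/
theorem exists_continuous_generator {X : Type*} [TopologicalSpace X] [T2Space X] [CompactSpace X]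
    [SecondCountableTopology X] [TotallyDisconnectedSpace X] {T : X ≃ₜ X}
    (haper : Aperiodic' T.toEquiv) :
    ∃ f : X → OnePoint ℕ, Continuous f ∧
      Function.Injective fun (x : X) (n : ℤ) => f ((T ^ n) x) := by
  obtain ⟨G, hG, hGT, hdisj⟩ := exists_disjoint_isClopen_meetsOrbits haper
  obtain ⟨B, hB, hsep⟩ := exists_seq_isClopen_separating X
  choose N hN using fun k => (hGT k).exists_bound (hG k)
  choose c hc hcB using fun k => exists_continuous_nat_code
    (fun i : Finset.Icc (-N k : ℤ) (N k) => (hB k).preimage_zpow (T := T) (i : ℤ))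
  obtain ⟨f, hf, hfG⟩ := exists_continuous_onePoint_of_disjoint hG hdisj hc
  refine ⟨f, hf, fun x y hxy => ?_⟩
  by_contra hne
  obtain ⟨k, hxk, hyk⟩ := hsep x y hne
  obtain ⟨i, hi, hxi⟩ := hN k x
  have hy := (congrFun hxy i).symm.trans ((hfG _ k _).2 ⟨hxi, rfl⟩)
  have hcode := hcB k _ _ ((hfG _ _ _).1 hy).2
    ⟨-i, by rw [Finset.mem_Icc] at hi ⊢; lia⟩
  simp only [mem_ofPred_eq, homeomorph_zpow_neg_apply] at hcode
  exact hyk (hcode.2 hxk)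

theorem stmt_11 {X : Type*} [MetricSpace X] [CompactSpace X] [Nonempty X] (T : X ≃ₜ X)
    (hzero : ZeroDim X) (haper : Aperiodic' T.toEquiv) :
    ∃ Y : Set (ℤ → OnePoint ℕ),
      Y.Nonempty ∧ IsClosed Y ∧ shiftMap '' Y = Y ∧
      ∃ φ : X ≃ₜ Y, ∀ x : X,
        ((φ (T x) : ℤ → OnePoint ℕ)) = shiftMap ((φ x : ℤ → OnePoint ℕ)) := by
  have := hzero.totallyDisconnectedSpace
  obtain ⟨f, hf, hinj⟩ := exists_continuous_generator haper
  set Φ : X → ℤ → OnePoint ℕ := fun x n => f ((T ^ n) x) with hΦ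
  have hcont : Continuous Φ := continuous_pi fun n => hf.comp (T ^ n).continuous
  have hemb : IsClosedEmbedding Φ := hcont.isClosedEmbedding hinj
  have hshift : ∀ x, Φ (T x) = shiftMap (Φ x) := fun x => funext fun n => by
    simp only [hΦ, shiftMap, zpow_add_one]; rfl
  refine ⟨range Φ, range_nonempty Φ, hemb.isClosed_range, ?_, hemb.isEmbedding.toHomeomorph, hshift⟩
  rw [← range_comp, show shiftMap ∘ Φ = Φ ∘ T from funext fun x => (hshift x).symm,
    T.surjective.range_comp]
end
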